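/- The set of real numbers ξ such that liminf_{n→∞} n·(log n)·‖ξ n²‖ > 0 has full Hausdorff dimension. -/

import Mathlib

open Filter

noncomputable def nint (y : ℝ) : ℝ := |y - round y|


section cantor
open scoped NNReal ENNReal Topology

lemma cantor_dim (s : ℝ≥0) (hs : 0 < s) (M : ℕ → ℕ) (hM : ∀ k, 2 ≤ M k) (l : ℕ → ℝ)
    (hl0 : ∀ k, 0 < l k) (Good : ℕ → ℝ → Prop) (x0 : ℝ)
    (h0 : Good 0 x0) (C : ℝ) (hC : 0 ≤ C)
    (step : ∀ k x, Good k x → ∃ y : ℕ → ℝ,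
      (∀ i < M k, Good (k+1) (y i) ∧ x ≤ y i ∧ y i + l (k+1) ≤ x + l k) ∧
      ∀ i j, i < j → j < M k → y i + l (k+1) < y j ∧
        ((j:ℝ) - i + 1) ≤ C * (∏ i ∈ Finset.range (k+1), (M i : ℝ)) *
          (y j - y i - l (k+1)) ^ (s:ℝ)) :
    (s:ℝ≥0∞) ≤ dimH {x | ∃ X : ℕ → ℝ, ∀ k, Good k (X k) ∧ X k ≤ x ∧ x ≤ X k + l k} := by
  classical
  have step' : ∀ k x, ∃ y : ℕ → ℝ, Good k x → 
      (∀ i < M k, Good (k+1) (y i) ∧ x ≤ y i ∧ y i + l (k+1) ≤ x + l k) ∧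
      ∀ i j, i < j → j < M k → y i + l (k+1) < y j ∧
        ((j:ℝ) - i + 1) ≤ C * (∏ i ∈ Finset.range (k+1), (M i : ℝ)) *
          (y j - y i - l (k+1)) ^ (s:ℝ) := by
    intro k x
    by_cases h : Good k x
    · obtain ⟨y, hy⟩ := step k x h
      exact ⟨y, fun _ => hy⟩
    · exact ⟨fun _ => 0, fun h' => absurd h' h⟩
  choose child hchild using step'
  set Pi : ℕ → ℕ := fun k => ∏ i ∈ Finset.range k, M i with hPi
  have hPis : ∀ k, Pi (k+1) = Pi k * M k := fun k => Finset.prod_range_succ _ _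
  have hPipos : ∀ k, 0 < Pi k := fun k => Finset.prod_pos (fun i _ => by have := hM i; omega)
  have hPi2 : ∀ k, 2 ^ k ≤ Pi k := by
    intro k
    induction k with
    | zero => simp [hPi]
    | succ k ih => rw [hPis, pow_succ]; exact Nat.mul_le_mul ih (hM k)
  set A : ℕ → ℝ → ℕ := fun k t => ⌊t * Pi k⌋₊ with hA
  have hAdiv : ∀ k t, A (k+1) t / M k = A k t := by
    intro k t
    have hm : (M k : ℝ) ≠ 0 := by have := hM k; positivity
    simp only [hA]
    rw [← Nat.floor_div_natCast, hPis]
    push_cast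
    congr 1
    field_simp
  let X : ℕ → ℝ → ℝ := fun k t => Nat.rec x0 (fun k x => child k x (A (k+1) t % M k)) k
  have hX0 : ∀ t, X 0 t = x0 := fun t => rfl
  have hXs : ∀ k t, X (k+1) t = child k (X k t) (A (k+1) t % M k) := fun k t => rfl
  have hmod : ∀ k t, A (k+1) t % M k < M k := fun k t => Nat.mod_lt _ (by have := hM k; omega)
  have hXgood : ∀ k t, Good k (X k t) := by
    intro k t
    induction k with
    | zero => exact h0
    | succ k ih => rw [hXs]; exact ((hchild k _ ih).1 _ (hmod k t)).1
  have hXnest : ∀ k t, X k t ≤ X (k+1) t ∧ X (k+1) t + l (k+1) ≤ X k t + l k := by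
    intro k t
    rw [hXs]
    exact ((hchild k _ (hXgood k t)).1 _ (hmod k t)).2
  have hmono : ∀ t, Monotone (fun k => X k t) := fun t => monotone_nat_of_le_succ fun k => (hXnest k t).1
  have hanti : ∀ t, Antitone (fun k => X k t + l k) :=
    fun t => antitone_nat_of_succ_le fun k => (hXnest k t).2
  have hub : ∀ t j k, X j t ≤ X k t + l k := by
    intro t j k
    have h1 := hmono t (le_max_left j k)
    have h2 := hanti t (le_max_right j k)
    have h3 := hl0 (max j k)
    simp only at h1 h2
    linarith
  set g : ℝ → ℝ := fun t => ⨆ k, X k t with hg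
  have hg1 : ∀ t k, X k t ≤ g t := fun t k => 
    le_ciSup (f := fun k => X k t) ⟨X 0 t + l 0, by rintro _ ⟨j, rfl⟩; exact hub t j 0⟩ k
  have hg2 : ∀ t k, g t ≤ X k t + l k := fun t k => ciSup_le fun j => hub t j k
  have hsame : ∀ k t t', A k t = A k t' → X k t = X k t' := by
    intro k
    induction k with
    | zero => intro t t' _; rfl
    | succ k ih =>
      intro t t' h
      rw [hXs, hXs, h, ih t t' (by rw [← hAdiv k t, ← hAdiv k t', h])]
  have key : ∀ t t', 0 ≤ t → t < t' → t' < 1 → t' - t ≤ C * (g t' - g t) ^ (s:ℝ) ∧ g t < g t' := by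
    intro t t' ht htt ht'
    have hex : ∃ k, A k t ≠ A k t' := by
      obtain ⟨k, hk⟩ := exists_nat_gt (1 / (t' - t))
      have hd : 0 < t' - t := by linarith
      rw [div_lt_iff₀ hd] at hk
      have h2k : (k:ℝ) ≤ Pi k := by
        exact_mod_cast (Nat.lt_two_pow_self).le.trans (hPi2 k)
      refine ⟨k, fun h => ?_⟩
      have h1 := Nat.floor_le (a := t * Pi k) (by positivity)
      have h2 := Nat.lt_floor_add_one (t' * Pi k)
      simp only [hA] at h
      rw [← h] at h2
      nlinarith
    have hfind := Nat.find_spec hex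
    obtain ⟨k, hk⟩ : ∃ k, Nat.find hex = k + 1 := by
      rcases Nat.eq_zero_or_eq_succ_pred (Nat.find hex) with h | h
      · exfalso
        rw [h] at hfind
        apply hfind
        simp only [hA, hPi, Finset.range_zero, Finset.prod_empty, Nat.cast_one, mul_one]
        rw [Nat.floor_eq_zero.2 (by linarith), Nat.floor_eq_zero.2 ht']
      · exact ⟨_, h⟩
    have hkeq : A k t = A k t' := by
      by_contra h
      have := Nat.find_min' hex h
      omega
    rw [hk] at hfind
    have hle : A (k+1) t ≤ A (k+1) t' := Nat.floor_le_floor (by gcongr)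
    have hlt : A (k+1) t < A (k+1) t' := lt_of_le_of_ne hle hfind
    have e1 := Nat.div_add_mod (A (k+1) t) (M k)
    have e2 := Nat.div_add_mod (A (k+1) t') (M k)
    rw [hAdiv] at e1 e2
    rw [← hkeq] at e2
    set i := A (k+1) t % M k with hi
    set j := A (k+1) t' % M k with hj
    have hij : i < j := by omega
    obtain ⟨c1, c2⟩ := (hchild k _ (hXgood k t)).2 i j hij (hmod k t')
    have hPr : (∏ i ∈ Finset.range (k+1), (M i : ℝ)) = Pi (k+1) := by simp [hPi]
    rw [hPr] at c2
    have x1 : X (k+1) t = child k (X k t) i := hXs k t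
    have x2 : X (k+1) t' = child k (X k t) j := by rw [hXs, hsame k t t' hkeq]
    rw [← x1, ← x2] at c1 c2
    have u1 := hg2 t (k+1)
    have u2 := hg1 t' (k+1)
    have hp : (0:ℝ) < Pi (k+1) := by exact_mod_cast hPipos (k+1)
    have hdiff : (t' - t) * Pi (k+1) ≤ (j:ℝ) - i + 1 := by
      have h1 := Nat.floor_le (a := t * Pi (k+1)) (by positivity)
      have h2 := Nat.lt_floor_add_one (t' * Pi (k+1))
      change ((A (k+1) t : ℕ) : ℝ) ≤ _ at h1
      change _ < ((A (k+1) t' : ℕ) : ℝ) + 1 at h2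
      rw [← e1] at h1
      rw [← e2] at h2
      push_cast at h1 h2
      linarith
    refine ⟨?_, by linarith⟩
    have hpow : (X (k+1) t' - X (k+1) t - l (k+1)) ^ (s:ℝ) ≤ (g t' - g t) ^ (s:ℝ) :=
      Real.rpow_le_rpow (by linarith) (by linarith) s.2
    have h3 : (t' - t) * Pi (k+1) ≤ (C * (g t' - g t) ^ (s:ℝ)) * Pi (k+1) := by
      calc _ ≤ _ := hdiff
        _ ≤ _ := c2
        _ ≤ C * (Pi (k+1)) * (g t' - g t) ^ (s:ℝ) := by gcongr
        _ = _ := by ring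
    exact le_of_mul_le_mul_right h3 hp
  have hinj : Set.InjOn g (Set.Ico 0 1) := by
    intro t ht t' ht' h
    rcases lt_trichotomy t t' with h' | h' | h'
    · have := (key t t' ht.1 h' ht'.2).2; linarith
    · exact h'
    · have := (key t' t ht'.1 h' ht.2).2; linarith
  set f := Function.invFunOn g (Set.Ico 0 1) with hf
  have hfg : ∀ t ∈ Set.Ico (0:ℝ) 1, f (g t) = t := fun t ht => hinj.leftInvOn_invFunOn ht
  have hhold : HolderOnWith C.toNNReal s f (g '' Set.Ico 0 1) := by
    rintro _ ⟨t, ht, rfl⟩ _ ⟨t', ht', rfl⟩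
    rw [hfg t ht, hfg t' ht']
    have hh : dist t t' ≤ C * dist (g t) (g t') ^ (s:ℝ) := by
      rcases lt_trichotomy t t' with h' | h' | h'
      · have := key t t' ht.1 h' ht'.2
        rw [Real.dist_eq, Real.dist_eq, abs_sub_comm, abs_of_pos (by linarith), abs_sub_comm,
          abs_of_pos (by linarith)]
        exact this.1
      · rw [h', dist_self, dist_self]; positivity
      · have := key t' t ht'.1 h' ht.2
        rw [Real.dist_eq, Real.dist_eq, abs_of_pos (by linarith), 
          abs_of_pos (by linarith)]
        exact this.1
    rw [edist_dist, edist_dist, ENNReal.ofReal_rpow_of_nonneg (p := (s:ℝ)) dist_nonneg s.2]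
    rw [show ((C.toNNReal : ℝ≥0) : ℝ≥0∞) = ENNReal.ofReal C from rfl, ← ENNReal.ofReal_mul hC]
    exact ENNReal.ofReal_le_ofReal hh
  have h1 := hhold.dimH_image_le hs
  have himg : f '' (g '' Set.Ico 0 1) = Set.Ico 0 1 := by
    rw [Set.image_image]
    ext z
    constructor
    · rintro ⟨t, ht, rfl⟩; simp only [hfg t ht]; exact ht
    · intro hz; exact ⟨z, hz, hfg z hz⟩
  rw [himg, Real.dimH_of_nonempty_interior (by rw [interior_Ico]; exact ⟨1/2, by norm_num, by norm_num⟩)] at h1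
  have hs' : (s:ℝ≥0∞) ≠ 0 := by exact_mod_cast hs.ne'
  rw [ENNReal.le_div_iff_mul_le (Or.inl hs') (Or.inl ENNReal.coe_ne_top), Module.finrank_self, Nat.cast_one, one_mul] at h1
  refine h1.trans (dimH_mono ?_)
  rintro _ ⟨t, _, rfl⟩
  exact ⟨fun k => X k t, fun k => ⟨hXgood k t, hg1 t k, hg2 t k⟩⟩

end cantor


lemma card_sep {ι : Type*} (S : Finset ι) (f : ι → ℝ) (K : ℝ) (hK : 0 ≤ K)
    (h1 : ∀ x ∈ S, ∀ y ∈ S, x ≠ y → 1 ≤ |f x - f y|)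
    (h2 : ∀ x ∈ S, ∀ y ∈ S, f x - f y ≤ K) : (S.card : ℝ) ≤ 1 + K := by
  classical
  rcases S.eq_empty_or_nonempty with rfl | hne
  · simp; linarith
  obtain ⟨x0, hx0, hmin⟩ := S.exists_min_image f hne
  have : S.card ≤ (Finset.range (⌊K⌋₊ + 1)).card := by
    apply Finset.card_le_card_of_injOn (fun x => ⌊f x - f x0⌋₊)
    · intro x hx
      simp only [Finset.coe_range, Set.mem_Iio]
      exact Nat.lt_succ_of_le (Nat.floor_le_floor (h2 x hx x0 hx0))
    · intro x hx y hy hxy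
      by_contra hne'
      have h3 := h1 x hx y hy hne'
      have a1 := Nat.floor_le (sub_nonneg.2 (hmin x hx))
      have a2 := Nat.lt_floor_add_one (f x - f x0)
      have b1 := Nat.floor_le (sub_nonneg.2 (hmin y hy))
      have b2 := Nat.lt_floor_add_one (f y - f x0)
      simp only at hxy
      rw [hxy] at a1 a2
      have : |f x - f y| < 1 := by rw [abs_lt]; constructor <;> linarith
      linarith
  rw [Finset.card_range] at this
  have h4 := Nat.floor_le hK
  have : (S.card : ℝ) ≤ ⌊K⌋₊ + 1 := by exact_mod_cast this
  linarith

lemma lattice_count (S : Finset (ℤ × ℤ)) (P H E : ℝ) (hP : 0 < P) (hH : 0 < H) (hE : 0 ≤ E)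
    (a b : ℤ) (ha : 0 < a) (hb : 0 < b) (hHb : 2 * H < b)
    (hS1 : ∀ s ∈ S, ∀ t ∈ S, |((s.1 - t.1 : ℤ) : ℝ)| ≤ P)
    (hS2 : ∀ s ∈ S, |((s.1 * a - s.2 * b : ℤ) : ℝ)| ≤ H) :
    (S.card : ℝ) ≤ 1 + 8 * P * H / b + 2 * H / a + E ∨
    ∃ u u' : ℤ, 1 ≤ u ∧ 1 ≤ u' ∧ u * E ≤ P ∧ |((u * a - u' * b : ℤ) : ℝ)| * E ≤ 2 * H ∧
      (S.card : ℝ) ≤ 1 + 8 * P * H / b + 2 * H / a + P / u := by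
  classical
  have haR : (0:ℝ) < a := by exact_mod_cast ha
  have hbR : (0:ℝ) < b := by exact_mod_cast hb
  rcases Nat.lt_or_ge S.card 2 with hlt | hge
  · left
    have : (S.card : ℝ) ≤ 1 := by exact_mod_cast (by omega : S.card ≤ 1)
    have : 0 ≤ 8 * P * H / b + 2 * H / a := by positivity
    linarith
  set nm : ℤ × ℤ → ℝ := fun d => max (|(d.1:ℝ)| / P) (|((d.1 * a - d.2 * b : ℤ) : ℝ)| / (2 * H)) with hnm
  have hnm0 : ∀ d, 0 ≤ nm d := fun d => le_max_of_le_left (by positivity)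
  have hnmneg : ∀ d, nm (-d) = nm d := by
    intro d
    simp only [hnm, Prod.fst_neg, Prod.snd_neg]
    push_cast
    rw [abs_neg, show (-(d.1:ℝ) * a - -(d.2:ℝ) * b) = -(d.1 * a - d.2 * b) by ring, abs_neg]
  have hnm1 : ∀ s ∈ S, ∀ t ∈ S, nm (s - t) ≤ 1 := by
    intro s hs t ht
    apply max_le
    · rw [div_le_one hP]; exact hS1 s hs t ht
    · rw [div_le_one (by positivity)]
      have e1 := abs_le.1 (hS2 s hs)
      have e2 := abs_le.1 (hS2 t ht)
      simp only [Prod.fst_sub, Prod.snd_sub]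
      push_cast at e1 e2 ⊢
      rw [abs_le]
      constructor <;> nlinarith
  obtain ⟨⟨s0, t0⟩, hst, hmin⟩ := (S.offDiag).exists_min_image (fun st => nm (st.1 - st.2)) (by
    obtain ⟨x, hx, y, hy, hxy⟩ := Finset.one_lt_card.1 hge
    exact ⟨(x, y), Finset.mem_offDiag.2 ⟨hx, hy, hxy⟩⟩)
  rw [Finset.mem_offDiag] at hst
  obtain ⟨hs0, ht0, hne0⟩ := hst
  simp only at hs0 ht0 hne0
  have hmin' : ∀ s ∈ S, ∀ t ∈ S, s ≠ t → nm (s0 - t0) ≤ nm (s - t) := fun s hs t ht h =>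
    hmin (s, t) (Finset.mem_offDiag.2 ⟨hs, ht, h⟩)
  have hle1 := hnm1 s0 hs0 t0 ht0
  -- first coordinate nonzero for any vector of norm ≤ 1
  have hu0 : ∀ d : ℤ × ℤ, nm d ≤ 1 → d.1 = 0 → d.2 = 0 := by
    intro d hd h0
    by_contra h2
    have := (le_max_right _ _).trans hd
    rw [div_le_one (by positivity), h0] at this
    push_cast at this
    rw [zero_mul, zero_sub, abs_neg, abs_mul, abs_of_pos hbR] at this
    have h3 : (1:ℝ) ≤ |(d.2:ℝ)| := by exact_mod_cast Int.one_le_abs h2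
    nlinarith
  -- choose sign
  obtain ⟨w, hw0, hw⟩ : ∃ w : ℤ × ℤ, 0 < w.1 ∧ nm w = nm (s0 - t0) := by
    rcases lt_trichotomy (s0 - t0).1 0 with h | h | h
    · exact ⟨-(s0 - t0), by simpa using h, hnmneg _⟩
    · exfalso
      have := hu0 _ hle1 h
      apply hne0
      apply Prod.ext
      · have : s0.1 - t0.1 = 0 := h
        omega
      · have : s0.2 - t0.2 = 0 := this
        omega
    · exact ⟨_, h, rfl⟩
  obtain ⟨u, u'⟩ := w
  simp only at hw0
  rw [← hw] at hmin' hle1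
  set lam := nm (u, u') with hlam
  have huR : (1:ℝ) ≤ u := by exact_mod_cast hw0
  have hl1 : (u:ℝ) / P ≤ lam := by
    have := le_max_left (|(u:ℝ)| / P) (|((u * a - u' * b : ℤ) : ℝ)| / (2 * H))
    calc (u:ℝ) / P = |(u:ℝ)| / P := by rw [abs_of_pos (show (0:ℝ) < u by linarith)]
      _ ≤ _ := this
  have hl2 : |((u * a - u' * b : ℤ) : ℝ)| / (2*H) ≤ lam := le_max_right _ _
  have hlpos : 0 < lam := lt_of_lt_of_le (by positivity) hl1
  have hl1' : (u:ℝ) ≤ lam * P := by rwa [div_le_iff₀ hP] at hl1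
  have hl2' : |((u * a - u' * b : ℤ) : ℝ)| ≤ lam * (2*H) := by rwa [div_le_iff₀ (by positivity)] at hl2
  have hnmscale : ∀ d : ℤ × ℤ, u' * d.1 = u * d.2 → nm d = |(d.1:ℝ) / u| * lam := by
    intro d hd
    have hd' : (u':ℝ) * d.1 = u * d.2 := by exact_mod_cast hd
    have hune : (u:ℝ) ≠ 0 := by linarith
    rw [hlam]
    simp only [hnm]
    rw [mul_max_of_nonneg _ _ (abs_nonneg _)]
    have e1 : (d.1:ℝ) = d.1 / u * u := by field_simp
    have e2 : ((d.1 * a - d.2 * b : ℤ) : ℝ) = d.1 / u * ((u * a - u' * b : ℤ) : ℝ) := by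
      push_cast
      field_simp
      linear_combination ((b:ℝ)) * hd'
    rw [e2, abs_mul, ← mul_div_assoc, ← mul_div_assoc, ← abs_mul, ← abs_mul, ← e1]
  set key : ℤ × ℤ → ℤ := fun s => u' * s.1 - u * s.2 with hkey
  have hfib : ∀ k ∈ S.image key, (((S.filter fun s => key s = k).card : ℕ) : ℝ) ≤ 1 + 1 / lam := by
    intro k _
    apply card_sep _ (fun s => (s.1:ℝ) / u) _ (by positivity)
    · intro x hx y hy hxy
      rw [Finset.mem_filter] at hx hy
      have hd : u' * (x - y).1 = u * (x - y).2 := by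
        have := hx.2.trans hy.2.symm
        simp only [hkey] at this
        simp only [Prod.fst_sub, Prod.snd_sub]
        linear_combination this
      have h1 := hmin' x hx.1 y hy.1 hxy
      rw [hnmscale _ hd] at h1
      have : 1 ≤ |(((x - y).1:ℤ):ℝ) / u| := by
        by_contra hcon
        push Not at hcon
        nlinarith
      simp only [Prod.fst_sub] at this
      push_cast at this
      rwa [sub_div] at this
    · intro x hx y hy
      rw [Finset.mem_filter] at hx hy
      have hd : u' * (x - y).1 = u * (x - y).2 := by
        have := hx.2.trans hy.2.symm
        simp only [hkey] at this
        simp only [Prod.fst_sub, Prod.snd_sub]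
        linear_combination this
      have h1 := hnm1 x hx.1 y hy.1
      rw [hnmscale _ hd] at h1
      simp only [Prod.fst_sub] at h1
      push_cast at h1
      rw [sub_div] at h1
      rw [le_div_iff₀ hlpos]
      have := le_abs_self ((x.1:ℝ)/u - y.1 / u)
      nlinarith
  have hnk : (((S.image key).card : ℕ) : ℝ) ≤ 1 + 4 * lam * P * H / b := by
    apply card_sep _ (fun k : ℤ => (k:ℝ)) _ (by positivity)
    · intro x _ y _ hxy
      have : (1:ℤ) ≤ |x - y| := Int.one_le_abs (sub_ne_zero.2 hxy)
      exact_mod_cast this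
    · intro x hx y hy
      rw [Finset.mem_image] at hx hy
      obtain ⟨s, hs, rfl⟩ := hx
      obtain ⟨t, ht, rfl⟩ := hy
      rw [le_div_iff₀ hbR]
      have a1 := hS1 s hs t ht
      have e1 := abs_le.1 (hS2 s hs)
      have e2 := abs_le.1 (hS2 t ht)
      simp only [hkey]
      push_cast at a1 e1 e2 hl2' ⊢
      set hu := (u:ℝ) * a - u' * b with hhu
      set d1 := (s.1:ℝ) - t.1 with hd1
      set hd := ((s.1:ℝ) * a - s.2 * b) - (t.1 * a - t.2 * b) with hhd
      have hid : ((u':ℝ) * s.1 - u * s.2 - (u' * t.1 - u * t.2)) * b = - hu * d1 + u * hd := by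
        rw [hhu, hd1, hhd]; ring
      rw [hid]
      have b1 : |hu * d1| ≤ (lam * (2*H)) * P := by
        rw [abs_mul]; exact mul_le_mul hl2' a1 (abs_nonneg _) (by positivity)
      have b2 : (u:ℝ) * hd ≤ (lam * P) * (2 * H) := by
        apply mul_le_mul_of_nonneg hl1' (by rw [hhd]; linarith [e1.2, e2.1]) (by linarith) (by positivity)
      have := neg_abs_le (hu * d1)
      nlinarith
  have hcard : (S.card : ℝ) ≤ (1 + 1/lam) * (1 + 4 * lam * P * H / b) := by
    rw [Finset.card_eq_sum_card_image key S]
    push_cast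
    calc _ ≤ ∑ k ∈ S.image key, (1 + 1/lam) := Finset.sum_le_sum hfib
      _ = (1 + 1/lam) * (S.image key).card := by rw [Finset.sum_const, nsmul_eq_mul]; ring
      _ ≤ _ := by gcongr
  have hcard2 : (S.card : ℝ) ≤ 1 + 8 * P * H / b + 1 / lam := by
    refine hcard.trans ?_
    have : (1 + 1/lam) * (1 + 4 * lam * P * H / b) = 1 + 1/lam + 4 * P * H / b * lam + 4 * P * H / b := by
      field_simp; ring
    rw [this]
    have : 4 * P * H / b * lam ≤ 4 * P * H / b * 1 := by gcongr
    have e : 8 * P * H / b = 4 * P * H / b + 4 * P * H / b := by ring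
    linarith
  have h2a : 0 < 2 * H / a := by positivity
  have hu'0 : 0 ≤ u' := by
    by_contra hcon
    have h1 : (u':ℝ) ≤ -1 := by exact_mod_cast (by omega : u' ≤ -1)
    have h2 := (abs_le.1 hl2').2
    push_cast at h2
    have : lam * (2*H) ≤ 2 * H := by nlinarith
    nlinarith
  by_cases hcase : 1 / lam ≤ E
  · left; linarith
  push Not at hcase
  rcases hu'0.eq_or_lt with h | h
  · left
    rw [← h] at hl2'
    push_cast at hl2'
    rw [zero_mul, sub_zero, abs_of_pos (by positivity)] at hl2'
    have : 1 / lam ≤ 2 * H / a := by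
      rw [div_le_div_iff₀ hlpos haR]
      nlinarith
    linarith
  · right
    have hE1 : lam * E ≤ 1 := by
      rw [lt_div_iff₀ hlpos] at hcase; linarith
    refine ⟨u, u', hw0, h, ?_, ?_, ?_⟩
    · nlinarith
    · calc _ ≤ lam * (2*H) * E := by gcongr
        _ = (lam * E) * (2 * H) := by ring
        _ ≤ 1 * (2 * H) := by gcongr
        _ = 2 * H := one_mul _
    · have : 1 / lam ≤ P / u := by
        rw [div_le_div_iff₀ hlpos (by linarith)]; linarith
      linarith


noncomputable def wv (t : ℝ) (m : ℕ) : ℝ := min 1 ((t / m) ^ 2)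

lemma wv_nonneg (t : ℝ) (m : ℕ) : 0 ≤ wv t m := le_min zero_le_one (sq_nonneg _)

lemma wv_sum_range (τ : ℝ) (hτ : 0 < τ) (J : ℕ) :
    ∑ j ∈ Finset.range J, wv τ (j + 1) ≤ 4 * τ * J / (J + τ) := by
  induction J with
  | zero => simp
  | succ J ih =>
    rw [Finset.sum_range_succ]
    have hJ : (0:ℝ) ≤ J := Nat.cast_nonneg J
    have h1 : wv τ (J+1) ≤ 4 * τ^2 / ((J + 1 + τ) * (J + τ)) := by
      unfold wv
      push_cast
      rw [le_div_iff₀ (by positivity)]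
      rcases le_total ((J:ℝ) + 1) τ with h | h
      · calc _ ≤ 1 * ((J + 1 + τ) * (J + τ)) := by gcongr; exact min_le_left _ _
          _ ≤ _ := by nlinarith
      · calc _ ≤ ((τ / (J+1))^2) * ((J + 1 + τ) * (J + τ)) := by gcongr; exact min_le_right _ _
          _ ≤ ((τ / (J+1))^2) * ((2 * (J + 1)) * (2 * (J + 1))) := by gcongr <;> linarith
          _ = _ := by field_simp; ring
    have h2 : 4 * τ * J / (J + τ) + 4 * τ^2 / ((J + 1 + τ) * (J + τ)) = 4 * τ * (J+1) / (J + 1 + τ) := by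
      field_simp; ring
    push_cast
    linarith

lemma wv_sum_class (t : ℝ) (ht : 0 < t) (d : ℕ) (hd : 0 < d) (S : Finset ℕ)
    (hS : ∀ x ∈ S, ∀ y ∈ S, x % d = y % d) :
    ∑ m ∈ S, wv t m ≤ 1 + 4 * t / d := by
  classical
  have hdR : (0:ℝ) < d := by exact_mod_cast hd
  set w : ℕ → ℝ := fun j => if j = 0 then 1 else wv (t/d) j with hw
  have hw0 : ∀ j, 0 ≤ w j := by
    intro j; simp only [hw]; split_ifs
    · norm_num
    · exact wv_nonneg _ _
  have hinj : Set.InjOn (fun m => m / d) (S : Set ℕ) := by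
    intro x hx y hy hxy
    have := hS x hx y hy
    rw [← Nat.div_add_mod x d, ← Nat.div_add_mod y d, this]
    simp only at hxy
    rw [hxy]
  have h1 : ∑ m ∈ S, wv t m ≤ ∑ m ∈ S, w (m / d) := by
    apply Finset.sum_le_sum
    intro m _
    simp only [hw]
    split_ifs with h
    · exact min_le_left _ _
    · apply min_le_min le_rfl
      have h0 : (0:ℝ) < (m/d : ℕ) := by exact_mod_cast Nat.pos_of_ne_zero h
      have h3 : ((m/d : ℕ):ℝ) ≤ m / d := Nat.cast_div_le
      have hm : (0:ℝ) < m := by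
        have : (0:ℝ) < (m:ℝ)/d := lt_of_lt_of_le h0 h3
        by_contra hcon
        have : (m:ℝ)/d ≤ 0 := div_nonpos_of_nonpos_of_nonneg (not_lt.1 hcon) hdR.le
        linarith
      have : t / m ≤ t / d / (m/d : ℕ) := by
        rw [div_div]
        apply div_le_div_of_nonneg_left ht.le (by positivity)
        rw [le_div_iff₀ hdR] at h3
        linarith
      gcongr
  have h2 : ∑ m ∈ S, w (m/d) = ∑ j ∈ S.image (fun m => m/d), w j := by
    rw [Finset.sum_image hinj]
  obtain ⟨J, hJ⟩ : ∃ J, S.image (fun m => m/d) ⊆ Finset.range (J+1) := by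
    refine ⟨(S.image (fun m => m/d)).sup id, fun x hx => ?_⟩
    rw [Finset.mem_range]
    exact Nat.lt_succ_of_le (Finset.le_sup (f := id) hx)
  have h3 : ∑ j ∈ S.image (fun m => m/d), w j ≤ ∑ j ∈ Finset.range (J+1), w j :=
    Finset.sum_le_sum_of_subset_of_nonneg hJ (fun j _ _ => hw0 j)
  have h4 : ∑ j ∈ Finset.range (J+1), w j = ∑ j ∈ Finset.range J, wv (t/d) (j+1) + 1 := by
    rw [Finset.sum_range_succ']
    simp [hw]
  have h5 := wv_sum_range (t/d) (by positivity) J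
  have h6 : 4 * (t/d) * J / (J + t/d) ≤ 4 * t / d := by
    rw [div_le_iff₀ (by positivity)]
    have : 0 ≤ 4 * (t/d) * (t/d) := by positivity
    have e : 4 * t / d = 4 * (t/d) := by ring
    rw [e]; nlinarith
  linarith

lemma inv_mlog_le (m : ℕ) (hm : 3 ≤ m) : 1 / ((m:ℝ) * Real.log m) ≤
    Real.log (Real.log m) - Real.log (Real.log ((m - 1 : ℕ))) := by
  have hm1 : (0:ℝ) < m := by positivity
  have hcast : ((m - 1 : ℕ):ℝ) = (m:ℝ) - 1 := by rw [Nat.cast_sub (by omega)]; norm_num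
  have h3 : (3:ℝ) ≤ m := by exact_mod_cast hm
  have l1 : 0 < Real.log m := Real.log_pos (by linarith)
  have l2 : 0 < Real.log ((m:ℝ) - 1) := Real.log_pos (by linarith)
  rw [hcast]
  have e1 : 1 / (m:ℝ) ≤ Real.log m - Real.log ((m:ℝ) - 1) := by
    have := Real.log_le_sub_one_of_pos (show 0 < ((m:ℝ)-1)/m by apply div_pos <;> linarith)
    rw [Real.log_div (by linarith) (by linarith)] at this
    have e : ((m:ℝ) - 1)/m - 1 = - (1/m) := by field_simp; ring
    linarith
  have e2 : 1 - Real.log ((m:ℝ) - 1) / Real.log m ≤ Real.log (Real.log m) - Real.log (Real.log ((m:ℝ) - 1)) := by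
    have := Real.log_le_sub_one_of_pos (div_pos l2 l1)
    rw [Real.log_div l2.ne' l1.ne'] at this
    linarith
  have e3 : 1 / ((m:ℝ) * Real.log m) ≤ 1 - Real.log ((m:ℝ) - 1) / Real.log m := by
    rw [← div_div, div_le_iff₀ l1, sub_mul, div_mul_cancel₀ _ l1.ne', one_mul]
    exact e1
  linarith

lemma sum_inv_mlog (a b : ℕ) (ha : 2 ≤ a) (hab : a ≤ b) :
    ∑ m ∈ Finset.Ioc a b, 1 / ((m:ℝ) * Real.log m) ≤ Real.log (Real.log b / Real.log a) := by
  have l1 : ∀ k : ℕ, 2 ≤ k → Real.log (k:ℝ) ≠ 0 := fun k hk => (Real.log_pos (by exact_mod_cast hk)).ne'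
  rw [Real.log_div (l1 b (by omega)) (l1 a ha)]
  induction b, hab using Nat.le_induction with
  | base => simp
  | succ b hab ih =>
    rw [← Finset.insert_Ioc_right_eq_Ioc_add_one hab, Finset.sum_insert (by simp)]
    have := inv_mlog_le (b+1) (by omega)
    rw [Nat.add_sub_cancel] at this
    linarith

lemma sum_inv_Icc (U : ℕ) : ∑ u ∈ Finset.Icc 1 U, 1 / (u:ℝ) ≤ 1 + Real.log U := by
  have := harmonic_le_one_add_log U
  rw [harmonic_eq_sum_Icc] at this
  push_cast at this
  simpa using this

/-- sum over multiples of d -/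
lemma sum_inv_dvd (U d : ℕ) (hd : 0 < d) :
    ∑ u ∈ (Finset.Icc 1 U).filter (fun u => d ∣ u), 1 / (u:ℝ) ≤ (1 + Real.log U) / d := by
  classical
  have hdR : (0:ℝ) < d := by exact_mod_cast hd
  have hinj : Set.InjOn (fun m => m / d) ((Finset.Icc 1 U).filter (fun u => d ∣ u) : Set ℕ) := by
    intro x hx y hy hxy
    simp only [Finset.coe_filter, Set.mem_setOf_eq] at hx hy hxy
    rw [← Nat.div_mul_cancel hx.2, ← Nat.div_mul_cancel hy.2, hxy]
  have h1 : ∑ u ∈ (Finset.Icc 1 U).filter (fun u => d ∣ u), 1 / (u:ℝ)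
      = ∑ u ∈ (Finset.Icc 1 U).filter (fun u => d ∣ u), 1 / ((u/d : ℕ):ℝ) / d := by
    apply Finset.sum_congr rfl
    intro u hu
    rw [Finset.mem_filter] at hu
    rw [Nat.cast_div hu.2 hdR.ne', div_div, div_mul_cancel₀ _ hdR.ne']
  rw [h1, ← Finset.sum_div]
  gcongr
  rw [← Finset.sum_image (f := fun u : ℕ => 1 / (u:ℝ)) hinj]
  refine le_trans (Finset.sum_le_sum_of_subset_of_nonneg ?_ (fun _ _ _ => by positivity)) (sum_inv_Icc U)
  intro x hx
  rw [Finset.mem_image] at hx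
  obtain ⟨u, hu, rfl⟩ := hx
  rw [Finset.mem_filter, Finset.mem_Icc] at hu
  rw [Finset.mem_Icc]
  exact ⟨Nat.div_pos (Nat.le_of_dvd (by omega) hu.2) hd, (Nat.div_le_self _ _).trans hu.1.2⟩


/-- bad lattice vectors -/
def Bad (q W : ℕ) (b m u : ℕ) (h : ℤ) : Prop :=
  u * m ^ 2 ≤ W ∧ ((q * b : ℕ) : ℤ) ^ 2 ∣ (u:ℤ) * m ^ 2 - h ∧ 1 ≤ (u:ℤ) * m ^ 2 - h ∧ ¬ (q * b ∣ m)

open Classical in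
noncomputable def Xs (q W U H : ℕ) (b m : ℕ) : ℝ :=
  ∑ u ∈ Finset.Icc 1 U, ∑ h ∈ Finset.Icc (-(H:ℤ)) H, if Bad q W b m u h then 1 / (u:ℝ) else 0

lemma int_coprime_of_not_dvd {p : ℕ} (hp : p.Prime) {x : ℤ} (h : ¬ (p:ℤ) ∣ x) (k : ℕ) :
    IsCoprime ((p:ℤ) ^ k) x := by
  apply IsCoprime.pow_left
  exact ((Nat.prime_iff_prime_int.1 hp).coprime_iff_not_dvd).2 h

lemma two_classes (q : ℕ) (hq : q.Prime) (hq2 : 2 < q) (u : ℕ) (h : ℤ) (hh : ¬ (q:ℤ) ∣ h)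
    (t : ℝ) (ht : 0 < t) (Ms : Finset ℕ) (hM : ∀ m ∈ Ms, (q:ℤ)^2 ∣ (u:ℤ) * m ^ 2 - h) :
    ∑ m ∈ Ms, wv t m ≤ 2 * (1 + 4 * t / (q^2 : ℕ)) := by
  classical
  rcases Ms.eq_empty_or_nonempty with rfl | ⟨m1, hm1⟩
  · simp; positivity
  have hqp : Prime (q:ℤ) := Nat.prime_iff_prime_int.1 hq
  have hqq : (q:ℤ) ∣ (q:ℤ)^2 := dvd_pow_self _ (by norm_num)
  have hd1 := hM m1 hm1
  have hu : ¬ (q:ℤ) ∣ u := by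
    intro hu
    apply hh
    have h1 := hqq.trans hd1
    have h2 : (q:ℤ) ∣ (u:ℤ) * m1^2 := hu.mul_right _
    have := dvd_sub h2 h1
    simpa using this
  have hm1q : ¬ (q:ℤ) ∣ m1 := by
    intro hu
    apply hh
    have h1 := hqq.trans hd1
    have h2 : (q:ℤ) ∣ (u:ℤ) * m1^2 := (hu.trans (dvd_pow_self _ (by norm_num))).mul_left _
    have := dvd_sub h2 h1
    simpa using this
  have hcl : ∀ m ∈ Ms, (q:ℤ)^2 ∣ (m:ℤ) - m1 ∨ (q:ℤ)^2 ∣ (m:ℤ) + m1 := by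
    intro m hm
    have h1 := dvd_sub (hM m hm) hd1
    have h2 : (q:ℤ)^2 ∣ (u:ℤ) * (((m:ℤ) - m1) * (m + m1)) := by
      rw [show (u:ℤ) * (((m:ℤ) - m1) * (m + m1)) = (u:ℤ) * m ^ 2 - h - ((u:ℤ) * m1 ^ 2 - h) by ring]; exact h1
    have h3 := (int_coprime_of_not_dvd hq hu 2).dvd_of_dvd_mul_left h2
    by_cases hc : (q:ℤ) ∣ (m:ℤ) - m1
    · left
      have : ¬ (q:ℤ) ∣ (m:ℤ) + m1 := by
        intro h4
        have h5 := dvd_sub h4 hc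
        have h6 : (q:ℤ) ∣ 2 * m1 := by rw [show (2:ℤ) * m1 = (m:ℤ) + m1 - ((m:ℤ) - m1) by ring]; exact h5
        rcases hqp.dvd_or_dvd h6 with h7 | h7
        · have := Int.le_of_dvd (by norm_num) h7
          omega
        · exact hm1q h7
      exact (int_coprime_of_not_dvd hq this 2).dvd_of_dvd_mul_right h3
    · right
      exact (int_coprime_of_not_dvd hq hc 2).dvd_of_dvd_mul_left h3
  have hsub : Ms ⊆ (Ms.filter fun m : ℕ => (q:ℤ)^2 ∣ (m:ℤ) - m1) ∪ (Ms.filter fun m : ℕ => (q:ℤ)^2 ∣ (m:ℤ) + m1) := by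
    intro m hm
    rw [Finset.mem_union, Finset.mem_filter, Finset.mem_filter]
    rcases hcl m hm with h | h
    · exact Or.inl ⟨hm, h⟩
    · exact Or.inr ⟨hm, h⟩
  have hmodc : ∀ x y : ℕ, (q:ℤ)^2 ∣ (x:ℤ) - y → x % (q^2) = y % (q^2) := by
    intro x y hxy
    have : (y:ℤ) ≡ x [ZMOD ((q^2 : ℕ):ℤ)] := by
      rw [Int.modEq_iff_dvd]; push_cast; exact hxy
    exact ((Int.natCast_modEq_iff).1 this).symm
  calc ∑ m ∈ Ms, wv t m ≤ ∑ m ∈ (Ms.filter fun m : ℕ => (q:ℤ)^2 ∣ (m:ℤ) - m1) ∪ (Ms.filter fun m : ℕ => (q:ℤ)^2 ∣ (m:ℤ) + m1), wv t m :=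
        Finset.sum_le_sum_of_subset_of_nonneg hsub (fun _ _ _ => wv_nonneg _ _)
    _ ≤ ∑ m ∈ (Ms.filter fun m : ℕ => (q:ℤ)^2 ∣ (m:ℤ) - m1), wv t m + ∑ m ∈ (Ms.filter fun m : ℕ => (q:ℤ)^2 ∣ (m:ℤ) + m1), wv t m := by
        rw [← Finset.sum_union_inter]
        exact le_add_of_nonneg_right (Finset.sum_nonneg fun _ _ => wv_nonneg _ _)
    _ ≤ (1 + 4 * t / (q^2 : ℕ)) + (1 + 4 * t / (q^2 : ℕ)) := by
        have hq0 : 0 < q^2 := by have := hq.pos; positivity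
        apply add_le_add
        · apply wv_sum_class t ht _ hq0
          intro x hx y hy
          rw [Finset.mem_filter] at hx hy
          apply hmodc
          have := dvd_sub hx.2 hy.2
          rw [show (x:ℤ) - y = (x:ℤ) - m1 - ((y:ℤ) - m1) by ring]; exact this
        · apply wv_sum_class t ht _ hq0
          intro x hx y hy
          rw [Finset.mem_filter] at hx hy
          apply hmodc
          have := dvd_sub hx.2 hy.2
          rw [show (x:ℤ) - y = (x:ℤ) + m1 - ((y:ℤ) + m1) by ring]; exact this
    _ = _ := by ring

lemma excess_bound (q : ℕ) (hq : q.Prime) (hq2 : 2 < q) (W U H B : ℕ) (t : ℝ) (ht : 0 < t)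
    (hHq : H < q) (hB : 0 < B) (hW : W + H < q^2 * B^4) (hU : U < B^2) 
    (PP : Finset ℕ) (hPP : ∀ b ∈ PP, b.Prime ∧ B < b ∧ b ≠ q) (Ms : Finset ℕ) :
    ∑ b ∈ PP, ∑ m ∈ Ms, wv t m * Xs q W U H b m ≤
      (1 + Real.log U) * ((2 * H + 1) * (2 * (1 + 4 * t / (q:ℝ)^2)) + PP.card / (q:ℝ)^2 * (1 + 4 * t / B)) := by
  classical
  have hqR : (0:ℝ) < q := by exact_mod_cast hq.pos
  have hqp : Prime (q:ℤ) := Nat.prime_iff_prime_int.1 hq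
  have hBR : (0:ℝ) < B := by exact_mod_cast hB
  -- reorganise
  have e1 : ∑ b ∈ PP, ∑ m ∈ Ms, wv t m * Xs q W U H b m =
      ∑ u ∈ Finset.Icc 1 U, ∑ h ∈ Finset.Icc (-(H:ℤ)) H, 1 / (u:ℝ) *
        ∑ m ∈ Ms, ∑ b ∈ PP, if Bad q W b m u h then wv t m else 0 := by
    unfold Xs
    simp_rw [Finset.mul_sum]
    rw [Finset.sum_comm]
    conv_lhs => enter [2, m]; rw [Finset.sum_comm]
    rw [Finset.sum_comm]
    refine Finset.sum_congr rfl fun u _ => ?_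
    conv_lhs => enter [2, m]; rw [Finset.sum_comm]
    rw [Finset.sum_comm]
    refine Finset.sum_congr rfl fun h _ => ?_
    refine Finset.sum_congr rfl fun m _ => ?_
    refine Finset.sum_congr rfl fun b _ => ?_
    split_ifs <;> ring
  have hne : ∀ (u : ℕ) (h : ℤ), h ∈ Finset.Icc (-(H:ℤ)) H → h ≠ 0 →
      ∑ m ∈ Ms, ∑ b ∈ PP, (if Bad q W b m u h then wv t m else 0) ≤ 2 * (1 + 4 * t / (q:ℝ)^2) := by
    intro u h hh h0
    rw [Finset.mem_Icc] at hh
    have hqh : ¬ (q:ℤ) ∣ h := by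
      intro hd
      have h1 := Int.le_of_dvd (abs_pos.2 h0) ((dvd_abs _ _).2 hd)
      have h2 : |h| ≤ H := abs_le.2 hh
      have : (H:ℤ) < q := by exact_mod_cast hHq
      linarith
    have hone : ∀ m ∈ Ms, ∑ b ∈ PP, (if Bad q W b m u h then wv t m else 0) ≤
        if (q:ℤ)^2 ∣ (u:ℤ) * m ^ 2 - h then wv t m else 0 := by
      intro m hm
      rw [← Finset.sum_filter, Finset.sum_const, nsmul_eq_mul]
      have hc : (PP.filter fun b => Bad q W b m u h).card ≤ 1 := by
        rw [Finset.card_le_one]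
        intro b hb b' hb'
        rw [Finset.mem_filter] at hb hb'
        by_contra hbb
        obtain ⟨p1, p2, p3⟩ := hPP b hb.1
        obtain ⟨p1', p2', p3'⟩ := hPP b' hb'.1
        obtain ⟨g1, g2, g3, g4⟩ := hb.2
        obtain ⟨g1', g2', g3', g4'⟩ := hb'.2
        have hcop : IsCoprime ((b:ℤ)^2) (((q * b':ℕ):ℤ)^2) := by
          apply IsCoprime.pow
          rw [Nat.isCoprime_iff_coprime]
          exact Nat.Coprime.mul_right ((Nat.coprime_primes p1 hq).2 p3) ((Nat.coprime_primes p1 p1').2 hbb)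
        have hd : (b:ℤ)^2 * ((q * b':ℕ):ℤ)^2 ∣ (u:ℤ) * m ^ 2 - h := by
          apply hcop.mul_dvd _ g2'
          refine dvd_trans ?_ g2
          push_cast
          exact pow_dvd_pow_of_dvd (dvd_mul_left _ _) 2
        have hle := Int.le_of_dvd (by linarith) hd
        have hWi : (u:ℤ) * m^2 ≤ W := by exact_mod_cast g1
        have hW' : (W:ℤ) + H < q^2 * B^4 := by exact_mod_cast hW
        have : (q:ℤ)^2 * B^4 ≤ (b:ℤ)^2 * ((q * b':ℕ):ℤ)^2 := by
          push_cast
          have x1 : (B:ℤ)^2 ≤ (b:ℤ)^2 := by gcongr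
          have x2 : (B:ℤ)^2 ≤ (b':ℤ)^2 := by gcongr
          calc (q:ℤ)^2 * B^4 = q^2 * (B^2 * B^2) := by ring
            _ ≤ q^2 * ((b:ℤ)^2 * (b':ℤ)^2) := by gcongr
            _ = _ := by ring
        linarith [hh.1]
      split_ifs with hdv
      · have : (((PP.filter fun b => Bad q W b m u h).card : ℕ):ℝ) ≤ 1 := by exact_mod_cast hc
        nlinarith [wv_nonneg t m]
      · have : (PP.filter fun b => Bad q W b m u h) = ∅ := by
          rw [Finset.filter_eq_empty_iff]
          intro b _ hb
          apply hdv
          refine dvd_trans ?_ hb.2.1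
          push_cast
          exact pow_dvd_pow_of_dvd (dvd_mul_right _ _) 2
        rw [this]; simp
    refine (Finset.sum_le_sum hone).trans ?_
    rw [← Finset.sum_filter]
    have := two_classes q hq hq2 u h hqh t ht (Ms.filter fun m : ℕ => (q:ℤ)^2 ∣ (u:ℤ) * m ^ 2 - h)
      (fun m hm => (Finset.mem_filter.1 hm).2)
    push_cast at this
    exact this
  have hzero : ∀ u ∈ Finset.Icc 1 U, 
      ∑ m ∈ Ms, ∑ b ∈ PP, (if Bad q W b m u 0 then wv t m else 0) ≤ 
        if q^2 ∣ u then PP.card * (1 + 4 * t / B) else 0 := by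
    intro u hu
    rw [Finset.mem_Icc] at hu
    have hkey : ∀ b ∈ PP, ∀ m, Bad q W b m u 0 → b ∣ m ∧ q^2 ∣ u := by
      intro b hb m hbad
      obtain ⟨p1, p2, p3⟩ := hPP b hb
      obtain ⟨g1, g2, g3, g4⟩ := hbad
      have g2' : (q * b)^2 ∣ u * m^2 := by
        rw [sub_zero] at g2
        exact_mod_cast g2
      have hbm : b ∣ m := by
        by_contra hcon
        have h1 : b^2 ∣ u * m^2 := dvd_trans (pow_dvd_pow_of_dvd (dvd_mul_left _ _) 2) g2'
        have hc : Nat.Coprime (b^2) (m^2) := Nat.Coprime.pow _ _ ((p1.coprime_iff_not_dvd).2 hcon)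
        have h2 := Nat.le_of_dvd (by omega) (hc.dvd_of_dvd_mul_right h1)
        have : B^2 ≤ b^2 := by gcongr
        omega
      refine ⟨hbm, ?_⟩
      have hqm : ¬ q ∣ m := by
        intro hqm
        apply g4
        exact Nat.Coprime.mul_dvd_of_dvd_of_dvd ((Nat.coprime_primes hq p1).2 (Ne.symm p3)) hqm hbm
      have h1 : q^2 ∣ u * m^2 := dvd_trans (pow_dvd_pow_of_dvd (dvd_mul_right _ _) 2) g2'
      have hc : Nat.Coprime (q^2) (m^2) := Nat.Coprime.pow _ _ ((hq.coprime_iff_not_dvd).2 hqm)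
      exact hc.dvd_of_dvd_mul_right h1
    split_ifs with hd
    · rw [Finset.sum_comm]
      have : ∀ b ∈ PP, ∑ m ∈ Ms, (if Bad q W b m u 0 then wv t m else 0) ≤ 1 + 4 * t / B := by
        intro b hb
        obtain ⟨p1, p2, p3⟩ := hPP b hb
        rw [← Finset.sum_filter]
        refine (wv_sum_class t ht b p1.pos _ ?_).trans ?_
        · intro x hx y hy
          rw [Finset.mem_filter] at hx hy
          rw [Nat.mod_eq_zero_of_dvd (hkey b hb x hx.2).1, Nat.mod_eq_zero_of_dvd (hkey b hb y hy.2).1]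
        · gcongr
      refine (Finset.sum_le_sum this).trans ?_
      rw [Finset.sum_const, nsmul_eq_mul]
    · apply Finset.sum_nonpos
      intro m _
      apply Finset.sum_nonpos
      intro b hb
      rw [if_neg]
      intro hbad
      exact hd (hkey b hb m hbad).2
  rw [e1]
  have e2 : ∀ u ∈ Finset.Icc 1 U, ∑ h ∈ Finset.Icc (-(H:ℤ)) H, 1 / (u:ℝ) *
        (∑ m ∈ Ms, ∑ b ∈ PP, if Bad q W b m u h then wv t m else 0) ≤ 
        1 / (u:ℝ) * ((2 * H + 1) * (2 * (1 + 4 * t / (q:ℝ)^2))) + 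
        (if q^2 ∣ u then 1 / (u:ℝ) else 0) * (PP.card * (1 + 4 * t / B)) := by
    intro u hu
    have hterm : ∀ h ∈ Finset.Icc (-(H:ℤ)) H, 1 / (u:ℝ) *
        (∑ m ∈ Ms, ∑ b ∈ PP, if Bad q W b m u h then wv t m else 0) ≤ 
        1 / (u:ℝ) * (2 * (1 + 4 * t / (q:ℝ)^2)) + 
        if h = 0 then (if q^2 ∣ u then 1 / (u:ℝ) else 0) * (PP.card * (1 + 4 * t / B)) else 0 := by
      intro h hh
      split_ifs with h0 hd
      · subst h0
        have := hzero u hu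
        rw [if_pos hd] at this
        have h2 : 0 ≤ 1 / (u:ℝ) * (2 * (1 + 4 * t / (q:ℝ)^2)) := by positivity
        have h3 : 1 / (u:ℝ) * (∑ m ∈ Ms, ∑ b ∈ PP, if Bad q W b m u 0 then wv t m else 0) ≤ 1 / (u:ℝ) * (PP.card * (1 + 4 * t / B)) := by gcongr
        linarith
      · subst h0
        have := hzero u hu
        rw [if_neg hd] at this
        have h2 : 0 ≤ 1 / (u:ℝ) * (2 * (1 + 4 * t / (q:ℝ)^2)) := by positivity
        have h3 : 1 / (u:ℝ) * (∑ m ∈ Ms, ∑ b ∈ PP, if Bad q W b m u 0 then wv t m else 0) ≤ 1 / (u:ℝ) * 0 := by gcongr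
        linarith
      · rw [add_zero]
        gcongr
        exact hne u h hh h0
    refine (Finset.sum_le_sum hterm).trans ?_
    rw [Finset.sum_add_distrib, Finset.sum_const, Finset.sum_ite_eq', if_pos (by simp), nsmul_eq_mul,
      Int.card_Icc]
    have : (((H:ℤ) + 1 - -(H:ℤ)).toNat : ℝ) = 2 * H + 1 := by
      have : ((H:ℤ) + 1 - -(H:ℤ)).toNat = 2 * H + 1 := by omega
      rw [this]; push_cast; ring
    rw [this]
    apply le_of_eq; ring
  refine (Finset.sum_le_sum e2).trans ?_
  rw [Finset.sum_add_distrib, ← Finset.sum_mul, ← Finset.sum_mul, ← Finset.sum_filter]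
  have s1 := sum_inv_Icc U
  have s2 := sum_inv_dvd U (q^2) (by have := hq.pos; positivity)
  push_cast at s2
  have : (1 + Real.log U) * ((2 * H + 1) * (2 * (1 + 4 * t / (q:ℝ)^2)) + PP.card / (q:ℝ)^2 * (1 + 4 * t / B)) =
    (1 + Real.log U) * ((2 * H + 1) * (2 * (1 + 4 * t / (q:ℝ)^2))) + (1 + Real.log U) / (q:ℝ)^2 * (PP.card * (1 + 4 * t / B)) := by
    field_simp
  rw [this]
  gcongr


lemma primes_count : ∃ B0 : ℕ, ∀ B : ℕ, B0 ≤ B →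
    (B:ℝ) / (2 * Real.log B) ≤ (((Finset.Ioc B (4*B)).filter Nat.Prime).card : ℝ) := by
  have h1 : ∀ᶠ x : ℝ in atTop, Real.log x ≤ 1/100 * Real.sqrt x := by
    have := (isLittleO_log_rpow_atTop (r := 1/2) (by norm_num)).def (c := 1/100) (by norm_num)
    filter_upwards [this, eventually_ge_atTop 1] with x hx hx1
    rw [Real.norm_of_nonneg (Real.log_nonneg hx1), Real.norm_of_nonneg (by positivity), ← Real.sqrt_eq_rpow] at hx
    exact hx
  obtain ⟨x0, hx0⟩ := eventually_atTop.1 h1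
  obtain ⟨B0, hB0⟩ := exists_nat_ge (max x0 100)
  refine ⟨B0, fun B hB => ?_⟩
  have hBR : (B0:ℝ) ≤ B := by exact_mod_cast hB
  have hb1 : x0 ≤ B := (le_max_left _ _).trans (hB0.trans hBR)
  have hb2 : 100 ≤ (B:ℝ) := (le_max_right _ _).trans (hB0.trans hBR)
  have t1 := Chebyshev.theta_ge (4 * B)
  have t2 := Chebyshev.theta_le_log4_mul_x (show (0:ℝ) ≤ B by linarith)
  push_cast at t1
  have hs := Real.sq_sqrt (show (0:ℝ) ≤ 4 * B by linarith)
  have hl := hx0 (4 * B) (by linarith)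
  have hl' := hx0 (4 * B + 1) (by linarith)
  have hs0 := Real.sqrt_nonneg (4 * (B:ℝ))
  have hs' : Real.sqrt (4 * B + 1) ≤ 4 * B + 1 := by
    rw [Real.sqrt_le_left (by linarith)]; nlinarith
  have hlog4 : Real.log 4 = 2 * Real.log 2 := by
    rw [show (4:ℝ) = 2^2 by norm_num, Real.log_pow]; norm_num
  have h2 := Real.log_two_gt_d9
  have t3 : (B:ℝ) ≤ Chebyshev.theta (4 * B) - Chebyshev.theta B := by
    rw [hlog4] at t2
    nlinarith
  have e : Chebyshev.theta (4 * B) - Chebyshev.theta B = ∑ p ∈ (Finset.Ioc B (4*B)).filter Nat.Prime, Real.log p := by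
    have a1 := Chebyshev.theta_eq_sum_Icc (4 * B : ℝ)
    have a2 := Chebyshev.theta_eq_sum_Icc (B:ℝ)
    rw [show (4 * (B:ℝ)) = ((4 * B : ℕ):ℝ) by push_cast; ring] at a1 ⊢
    rw [Nat.floor_natCast] at a1 a2
    rw [a1, a2, Finset.sum_filter, Finset.sum_filter, Finset.sum_filter, sub_eq_iff_eq_add]
    rw [← Finset.sum_union]
    · congr 1
      ext x; simp; omega
    · rw [Finset.disjoint_left]; intro x; simp; omega
  have hlogB : Real.log (4 * B) ≤ 2 * Real.log B := by
    rw [show 2 * Real.log B = Real.log ((B:ℝ)^2) by rw [Real.log_pow]; norm_num]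
    apply Real.log_le_log (by linarith); nlinarith
  have hlogpos : 0 < Real.log B := Real.log_pos (by linarith)
  rw [div_le_iff₀ (by positivity)]
  calc (B:ℝ) ≤ _ := t3
    _ = _ := e
    _ ≤ ∑ p ∈ (Finset.Ioc B (4*B)).filter Nat.Prime, (2 * Real.log B) := by
      apply Finset.sum_le_sum
      intro p hp
      rw [Finset.mem_filter, Finset.mem_Ioc] at hp
      refine le_trans (Real.log_le_log (by exact_mod_cast hp.2.pos) ?_) hlogB
      exact_mod_cast hp.1.2
    _ = _ := by rw [Finset.sum_const, nsmul_eq_mul]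


noncomputable def dl (m : ℕ) : ℝ := 1 / ((m:ℝ)^3 * Real.log m)

lemma log_nat_pos {m : ℕ} (hm : 2 ≤ m) : 0 < Real.log m := Real.log_pos (by exact_mod_cast hm)

lemma dl_pos {m : ℕ} (hm : 2 ≤ m) : 0 < dl m := by
  have := log_nat_pos hm
  unfold dl
  positivity

lemma dl_anti {m n : ℕ} (hm : 2 ≤ m) (h : m ≤ n) : dl n ≤ dl m := by
  have := log_nat_pos hm
  unfold dl
  gcongr

noncomputable def Qf (l : ℝ) : ℕ := Nat.sqrt ⌊1 / (256 * l)⌋₊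

lemma le_Qf {l : ℝ} (hl : 0 < l) (m : ℕ) : m ≤ Qf l ↔ 256 * l * (m:ℝ)^2 ≤ 1 := by
  unfold Qf
  rw [Nat.le_sqrt, Nat.le_floor_iff (by positivity), le_div_iff₀ (by positivity)]
  push_cast
  constructor <;> intro h <;> nlinarith

lemma Qf_lt {l : ℝ} (hl : 0 < l) (m : ℕ) : Qf l < m ↔ 1 < 256 * l * (m:ℝ)^2 := by
  rw [← not_le, le_Qf hl, not_le]

noncomputable def rset (m : ℕ) (x l : ℝ) : Finset ℤ :=
  Finset.Icc ⌈(m:ℝ)^2 * (x - dl m)⌉ ⌊(m:ℝ)^2 * (x + l + dl m)⌋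

noncomputable def Fut (x l : ℝ) (S Q : ℕ) : ℝ := ∑ m ∈ Finset.Ioc S Q, ((rset m x l).card : ℝ) * dl m

noncomputable def cand (N : ℕ) (x l : ℝ) (n : ℕ) : Finset ℤ :=
  Finset.Icc ⌈(n:ℝ)^2 * x⌉ ⌊(n:ℝ)^2 * (x + l - 2 * dl N)⌋

noncomputable def rho (c : ℝ) (N m : ℕ) : ℝ := c * dl m + 3 * dl N

noncomputable def Tset (N : ℕ) (x l : ℝ) (n m : ℕ) (r : ℝ) : Finset (ℤ × ℤ) :=
  ((cand N x l n) ×ˢ (Finset.Icc ⌈(m:ℝ)^2 * (x - r)⌉ ⌊(m:ℝ)^2 * (x + l + r)⌋)).filter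
    (fun s => |(s.1:ℝ) / (n:ℝ)^2 - (s.2:ℝ) / (m:ℝ)^2| ≤ r)

lemma mem_cand {N : ℕ} {x l : ℝ} {n : ℕ} (hn : 0 < n) {p : ℤ} : p ∈ cand N x l n ↔
    x ≤ (p:ℝ) / (n:ℝ)^2 ∧ (p:ℝ) / (n:ℝ)^2 ≤ x + l - 2 * dl N := by
  unfold cand
  have : (0:ℝ) < (n:ℝ)^2 := by positivity
  rw [Finset.mem_Icc, Int.ceil_le, Int.le_floor, le_div_iff₀ this, div_le_iff₀ this, mul_comm, 
    mul_comm _ (x + l - 2 * dl N)]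

lemma mem_rset {m : ℕ} {x l : ℝ} (hm : 0 < m) {p : ℤ} : p ∈ rset m x l ↔
    x - dl m ≤ (p:ℝ) / (m:ℝ)^2 ∧ (p:ℝ) / (m:ℝ)^2 ≤ x + l + dl m := by
  unfold rset
  have : (0:ℝ) < (m:ℝ)^2 := by positivity
  rw [Finset.mem_Icc, Int.ceil_le, Int.le_floor, le_div_iff₀ this, div_le_iff₀ this, mul_comm, 
    mul_comm _ (x + l + dl m)]

lemma mem_Tset {N : ℕ} {x l : ℝ} (hd : 0 ≤ dl N) {n m : ℕ} (hn : 0 < n) (hm : 0 < m) {r : ℝ} {s : ℤ × ℤ} :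
    s ∈ Tset N x l n m r ↔ s.1 ∈ cand N x l n ∧ |(s.1:ℝ) / (n:ℝ)^2 - (s.2:ℝ) / (m:ℝ)^2| ≤ r := by
  unfold Tset
  rw [Finset.mem_filter, Finset.mem_product]
  constructor
  · rintro ⟨⟨h1, _⟩, h2⟩; exact ⟨h1, h2⟩
  · rintro ⟨h1, h2⟩
    refine ⟨⟨h1, ?_⟩, h2⟩
    rw [mem_cand hn] at h1
    rw [abs_le] at h2
    have : (0:ℝ) < (m:ℝ)^2 := by positivity
    rw [Finset.mem_Icc, Int.ceil_le, Int.le_floor, mul_comm, mul_comm _ (x + l + r), ← le_div_iff₀ this, ← div_le_iff₀ this]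
    constructor <;> linarith [h1.1, h1.2, h2.1, h2.2]

def PB (B : ℕ) : Finset ℕ := (Finset.Ioc B (4*B)).filter Nat.Prime

noncomputable def Uf (l : ℝ) (N : ℕ) : ℕ := ⌊4 / l * N⌋₊
noncomputable def Wf (l : ℝ) (N : ℕ) : ℕ := ⌊64 / l * (N:ℝ)^3⌋₊
noncomputable def Hf (l : ℝ) : ℕ := ⌊400 / l^2⌋₊

structure SH (l c : ℝ) (q B N : ℕ) : Prop where
  hl : 0 < l
  hc : 0 < c
  hc1 : c ≤ 1 / 10^6
  hq : q.Prime
  hq2 : 2 < q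
  hqB : q ≤ B
  hN : N = q * B
  hH : 400 / l^2 < q
  hW : 64 / l * (N:ℝ)^3 + 400 / l^2 < (q:ℝ)^2 * (B:ℝ)^4
  hU : 4 / l * N < (B:ℝ)^2
  hL : 2 * 10^8 ≤ Real.log N
  hG : 1 + Real.log (4 * N) ≤ 1 / (1000 * l)
  hGN : 3 / l^2 ≤ c * (N:ℝ)^2
  hQ2 : 2 ≤ Qf l
  hLam : 640 * c * (∑ m ∈ Finset.Ioc (Qf l) (4 * N), 1 / ((m:ℝ) * Real.log m)) ≤ 1/1000
  hExc : (1 + Real.log (Uf l N)) * ((2 * (Hf l) + 1) * (2 * (1 + 4 * (4 * N) / (q:ℝ)^2)) + 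
      (PB B).card / (q:ℝ)^2 * (1 + 4 * (4 * N) / B)) ≤ (PB B).card / 1000

namespace SH
variable {l c : ℝ} {q B N : ℕ}

lemma Bpos (h : SH l c q B N) : 0 < B := by have := h.hq.pos; have := h.hqB; omega
lemma Nbig (h : SH l c q B N) : 2 * 10^8 ≤ (N:ℝ) := by
  have h1 := h.hL
  have : (0:ℝ) ≤ N := Nat.cast_nonneg N
  have := Real.log_le_self this
  linarith
lemma N2 (h : SH l c q B N) : 2 ≤ N := by
  have := h.Nbig
  have : (2:ℝ) ≤ N := by linarith
  exact_mod_cast this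
lemma Npos (h : SH l c q B N) : (0:ℝ) < N := by linarith [h.Nbig]
lemma dpos (h : SH l c q B N) : 0 < dl N := dl_pos h.N2
lemma Gbig (h : SH l c q B N) : 2 * 10^11 ≤ 1 / l := by
  have h1 := h.hG
  have h2 := h.hL
  have h3 : Real.log N ≤ Real.log (4 * N) := Real.log_le_log h.Npos (by linarith [h.Npos])
  have e : 1 / (1000 * l) = 1 / l / 1000 := by rw [mul_comm, div_div]
  rw [e] at h1
  linarith
lemma NG (h : SH l c q B N) : 1000 * (1 / l) ≤ N := by
  have h1 := h.hGN
  have h2 := h.hc1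
  have h3 := h.Npos
  have h4 := h.hl
  have h5 : 3 * (1 / l)^2 ≤ 1 / 10^6 * (N:ℝ)^2 := by
    calc 3 * (1/l)^2 = 3 / l^2 := by rw [div_pow]; ring
      _ ≤ _ := h1
      _ ≤ _ := by gcongr
  have h6 : 0 < 1 / l := by positivity
  by_contra hcon
  push Not at hcon
  nlinarith
/-- dl N * N^3 * log N = 1 -/
lemma dmul (h : SH l c q B N) : dl N * ((N:ℝ)^3 * Real.log N) = 1 := by
  unfold dl
  have := h.Npos
  have : 0 < Real.log N := by linarith [h.hL]
  field_simp
lemma d3 (h : SH l c q B N) : dl N * (N:ℝ)^3 ≤ 1 / (2*10^8) := by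
  have h1 := h.dmul
  have h2 := h.hL
  have h3 := h.dpos
  have h4 := h.Npos
  have : 0 < dl N * (N:ℝ)^3 := by positivity
  rw [le_div_iff₀ (by norm_num)]
  calc _ ≤ dl N * (N:ℝ)^3 * Real.log N := by gcongr
    _ = 1 := by rw [← h1]; ring
lemma d2 (h : SH l c q B N) : dl N * (N:ℝ)^2 ≤ 1 / (10^16) := by
  have h1 := h.d3
  have h2 := h.Nbig
  have h3 := h.dpos
  have : 0 < dl N * (N:ℝ)^2 := by positivity
  have : dl N * (N:ℝ)^2 * N ≤ 1 / (2*10^8) := by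
    calc _ = dl N * (N:ℝ)^3 := by ring
      _ ≤ _ := h1
  rw [le_div_iff₀ (by norm_num)]
  rw [le_div_iff₀ (by norm_num)] at this
  nlinarith
lemma dN1 (h : SH l c q B N) (c1 : ℝ) (hc : 0 ≤ c1) : c1 * dl N * (N:ℝ)^2 ≤ c1 * (1 / 10^16) := by
  have := h.d2
  rw [mul_assoc]
  gcongr
lemma N4Q (h : SH l c q B N) : 4 * N ≤ Qf (dl N) := by
  rw [le_Qf h.dpos]
  push_cast
  have := h.d2
  nlinarith
lemma QlN (h : SH l c q B N) : Qf l < N := by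
  rw [Qf_lt h.hl]
  have h1 := h.NG
  have h2 := h.Nbig
  have h3 := h.hl
  have : 1000 ≤ (N:ℝ) * l := by
    have := mul_le_mul_of_nonneg_right h1 h3.le
    have e : 1000 * (1/l) * l = 1000 := by field_simp
    linarith
  nlinarith
end SH


lemma m2dl {m : ℕ} (hm : 2 ≤ m) : (m:ℝ)^2 * dl m = 1 / ((m:ℝ) * Real.log m) := by
  unfold dl
  have := log_nat_pos hm
  field_simp

lemma m2dl_le {m : ℕ} (hm : 2 ≤ m) : (m:ℝ)^2 * dl m ≤ 1 := by
  rw [m2dl hm, div_le_one (mul_pos (by positivity) (log_nat_pos hm))]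
  have h1 : Real.log 2 ≤ Real.log m := Real.log_le_log (by norm_num) (by exact_mod_cast hm)
  have h2 := Real.log_two_gt_d9
  have h3 : (2:ℝ) ≤ m := by exact_mod_cast hm
  nlinarith

namespace SH
variable {l c : ℝ} {q B N : ℕ}

lemma nb (h : SH l c q B N) {b : ℕ} (hb : b ∈ PB B) : N < q * b ∧ q * b ≤ 4 * N ∧ b.Prime ∧ B < b ∧ b ≠ q := by
  unfold PB at hb
  rw [Finset.mem_filter, Finset.mem_Ioc] at hb
  have := h.hq.pos
  have h2 := h.hqB
  refine ⟨?_, ?_, hb.2, hb.1.1, by omega⟩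
  · rw [h.hN]; exact Nat.mul_lt_mul_of_pos_left hb.1.1 this
  · rw [h.hN]; calc q * b ≤ q * (4 * B) := Nat.mul_le_mul_left _ hb.1.2
      _ = _ := by ring

lemma T_bound (h : SH l c q B N) (x : ℝ) {b : ℕ} (hb : b ∈ PB B) {m : ℕ} (hQ : Qf l < m)
    (hm : m ≤ Qf (dl N)) (hnd : ¬ q * b ∣ m) (E : ℝ) (hE : 0 < E)
    (hEu : ∀ u : ℝ, 1 ≤ u → u * E ≤ 16 * l * (N:ℝ)^2 → u ≤ 4 / l * N ∧ u * (m:ℝ)^2 ≤ 64 / l * (N:ℝ)^3)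
    (hEh : 2 * (16 * (N:ℝ)^2 * (m:ℝ)^2 * rho c N m) ≤ 400 / l^2 * E) :
    ((Tset N x l (q * b) m (rho c N m)).card : ℝ) ≤ 
      1 + 640 * (16 * l * (N:ℝ)^2) * ((m:ℝ)^2 * rho c N m) + E + 
        (16 * l * (N:ℝ)^2) * Xs q (Wf l N) (Uf l N) (Hf l) b m := by
  classical
  obtain ⟨n1, n2, n3, n4, n5⟩ := h.nb hb
  set n := q * b with hn
  have hm2 : 2 ≤ m := by have := h.hQ2; omega
  have hl := h.hl
  have hNp := h.Npos
  have hnN : (N:ℝ) ≤ n := by exact_mod_cast n1.le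
  have hnN' : (N:ℝ) < n := by exact_mod_cast n1
  have hn4 : (n:ℝ) ≤ 4 * N := by exact_mod_cast n2
  have hn0 : 0 < n := by omega
  have hn0R : (0:ℝ) < n := by exact_mod_cast hn0
  have hmR : (2:ℝ) ≤ m := by exact_mod_cast hm2
  have hmR0 : (0:ℝ) < m := by linarith
  have hdp := h.dpos
  have hdm := dl_pos hm2
  have hc := h.hc
  have hc1 := h.hc1
  have hrho : 0 < rho c N m := by unfold rho; positivity
  set ρ := rho c N m with hρ
  have hmρ : 32 * ((m:ℝ)^2 * ρ) < 1 := by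
    have h1 := m2dl_le hm2
    have h2 := (le_Qf hdp m).1 hm
    rw [hρ]; unfold rho
    have : (m:ℝ)^2 * (c * dl m + 3 * dl N) = c * ((m:ℝ)^2 * dl m) + 3 * (dl N * (m:ℝ)^2) := by ring
    rw [this]
    have h3 : c * ((m:ℝ)^2 * dl m) ≤ 1/10^6 * 1 := by gcongr
    nlinarith
  set P := 16 * l * (N:ℝ)^2 with hP
  have hPp : 0 < P := by positivity
  set H := 16 * (N:ℝ)^2 * (m:ℝ)^2 * ρ with hH
  have hHp : 0 < H := by positivity
  have hn2 : (N:ℝ)^2 ≤ (n:ℝ)^2 := by gcongr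
  have hn2' : (n:ℝ)^2 ≤ 16 * (N:ℝ)^2 := by
    calc (n:ℝ)^2 ≤ (4 * N)^2 := by gcongr
      _ = _ := by ring
  have hHb : 2 * H < (((n:ℤ)^2 : ℤ) : ℝ) := by
    push_cast
    calc 2 * H = (N:ℝ)^2 * (32 * ((m:ℝ)^2 * ρ)) := by rw [hH]; ring
      _ < (N:ℝ)^2 * 1 := by gcongr
      _ ≤ _ := by linarith
  have hS1 : ∀ s ∈ Tset N x l n m ρ, ∀ t ∈ Tset N x l n m ρ, |((s.1 - t.1 : ℤ) : ℝ)| ≤ P := by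
    intro s hs t ht
    rw [mem_Tset hdp.le hn0 (by omega), mem_cand hn0] at hs ht
    obtain ⟨⟨s1, s2⟩, _⟩ := hs
    obtain ⟨⟨t1, t2⟩, _⟩ := ht
    have e : ((s.1 - t.1 : ℤ) : ℝ) = (n:ℝ)^2 * (s.1 / (n:ℝ)^2 - t.1 / (n:ℝ)^2) := by
      push_cast; field_simp
    rw [e, abs_mul, abs_of_pos (by positivity)]
    calc _ ≤ (16 * (N:ℝ)^2) * l := by
          gcongr
          rw [abs_le]; constructor <;> linarith
      _ = P := by rw [hP]; ring
  have hS2 : ∀ s ∈ Tset N x l n m ρ, |((s.1 * (m:ℤ)^2 - s.2 * (n:ℤ)^2 : ℤ) : ℝ)| ≤ H := by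
    intro s hs
    rw [mem_Tset hdp.le hn0 (by omega)] at hs
    have e : ((s.1 * (m:ℤ)^2 - s.2 * (n:ℤ)^2 : ℤ) : ℝ) = (n:ℝ)^2 * (m:ℝ)^2 * (s.1 / (n:ℝ)^2 - s.2 / (m:ℝ)^2) := by
      push_cast; field_simp
    rw [e, abs_mul, abs_of_pos (by positivity)]
    calc _ ≤ (16 * (N:ℝ)^2) * (m:ℝ)^2 * ρ := by
          gcongr
          exact hs.2
      _ = H := by rw [hH]
  have hmain : 8 * P * H / (((n:ℤ)^2 : ℤ) : ℝ) + 2 * H / (((m:ℤ)^2 : ℤ) : ℝ) ≤ 640 * P * ((m:ℝ)^2 * ρ) := by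
    push_cast
    have a1 : 8 * P * H / (n:ℝ)^2 ≤ 128 * P * ((m:ℝ)^2 * ρ) := by
      rw [div_le_iff₀ (by positivity)]
      calc 8 * P * H = 128 * P * ((m:ℝ)^2 * ρ) * (N:ℝ)^2 := by rw [hH]; ring
        _ ≤ _ := by gcongr
    have a2 : 2 * H / (m:ℝ)^2 ≤ 512 * P * ((m:ℝ)^2 * ρ) := by
      rw [div_le_iff₀ (by positivity)]
      have h1 := (Qf_lt hl m).1 hQ
      calc 2 * H = 32 * ((N:ℝ)^2 * (m:ℝ)^2 * ρ) * 1 := by rw [hH]; ring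
        _ ≤ 32 * ((N:ℝ)^2 * (m:ℝ)^2 * ρ) * (256 * l * (m:ℝ)^2) := by gcongr
        _ = _ := by rw [hP]; ring
    linarith
  have hX0 : 0 ≤ Xs q (Wf l N) (Uf l N) (Hf l) b m := by
    unfold Xs
    apply Finset.sum_nonneg; intro u _
    apply Finset.sum_nonneg; intro h _
    split_ifs <;> positivity
  rcases lattice_count (Tset N x l n m ρ) P H E hPp hHp hE.le ((m:ℤ)^2) ((n:ℤ)^2) (by positivity) (by positivity)
    hHb hS1 hS2 with hcase | ⟨u, u', hu, hu', c1, c2, c3⟩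
  · have : 0 ≤ P * Xs q (Wf l N) (Uf l N) (Hf l) b m := by positivity
    linarith
  · have hX : 1 / (u:ℝ) ≤ Xs q (Wf l N) (Uf l N) (Hf l) b m := by
      obtain ⟨v, rfl⟩ := Int.eq_ofNat_of_zero_le (show 0 ≤ u by omega)
      have hv : 1 ≤ v := by exact_mod_cast hu
      have hvR : (1:ℝ) ≤ v := by exact_mod_cast hv
      push_cast at c1 c2 
      set hh : ℤ := (v:ℤ) * (m:ℤ)^2 - u' * (n:ℤ)^2 with hhh
      obtain ⟨k1, k2⟩ := hEu v hvR c1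
      have m1 : v ∈ Finset.Icc 1 (Uf l N) := by
        rw [Finset.mem_Icc]
        exact ⟨hv, Nat.le_floor k1⟩
      have m2 : hh ∈ Finset.Icc (-((Hf l : ℕ):ℤ)) (Hf l) := by
        rw [Finset.mem_Icc, ← abs_le]
        have h1 : |(hh:ℝ)| ≤ 400 / l^2 := by
          have : |(hh:ℝ)| * E ≤ 400 / l^2 * E := by
            refine le_trans ?_ hEh
            rw [hhh]; push_cast; exact c2
          exact le_of_mul_le_mul_right this hE
        have h2 : |hh| = ((hh.natAbs : ℕ):ℤ) := Int.abs_eq_natAbs hh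
        rw [h2]
        have h3 : hh.natAbs ≤ Hf l := by
          apply Nat.le_floor
          rw [Nat.cast_natAbs]; push_cast; exact h1
        exact_mod_cast h3
      have hbad : Bad q (Wf l N) b m v hh := by
        refine ⟨?_, ?_, ?_, hnd⟩
        · apply Nat.le_floor; push_cast; exact k2
        · rw [hhh]
          refine ⟨u', ?_⟩
          rw [← hn]; ring
        · rw [hhh]
          have : (1:ℤ) ≤ u' * (n:ℤ)^2 := by
            have : (1:ℤ) ≤ (n:ℤ)^2 := by
              have : (0:ℤ) < (n:ℤ)^2 := by positivity
              omega
            nlinarith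
          linarith
      unfold Xs
      have p1 : ∀ u ∈ Finset.Icc 1 (Uf l N), 0 ≤ ∑ h ∈ Finset.Icc (-((Hf l : ℕ):ℤ)) (Hf l), 
          (if Bad q (Wf l N) b m u h then 1 / (u:ℝ) else 0) := by
        intro u _
        apply Finset.sum_nonneg; intro h _
        split_ifs <;> positivity
      refine le_trans ?_ (Finset.single_le_sum p1 m1)
      refine le_trans ?_ (Finset.single_le_sum (fun h _ => ?_) m2)
      · rw [if_pos hbad]; push_cast; exact le_rfl
      · split_ifs <;> positivity
    have : P / u ≤ P * Xs q (Wf l N) (Uf l N) (Hf l) b m := by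
      calc P / u = P * (1 / u) := by ring
        _ ≤ _ := by gcongr
    linarith

lemma T_A (h : SH l c q B N) (x : ℝ) {b : ℕ} (hb : b ∈ PB B) {m : ℕ} (hQ : Qf l < m)
    (hm : m ≤ 4 * N) (hnd : ¬ q * b ∣ m) : 
    ((Tset N x l (q * b) m (rho c N m)).card : ℝ) ≤ 
      1 + 640 * (16 * l * (N:ℝ)^2) * ((m:ℝ)^2 * rho c N m) + (16 * l * (N:ℝ)^2) * l / m + 
        (16 * l * (N:ℝ)^2) * Xs q (Wf l N) (Uf l N) (Hf l) b m := by
  have hm2 : 2 ≤ m := by have := h.hQ2; omega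
  have hmR : (2:ℝ) ≤ m := by exact_mod_cast hm2
  have hmN : (m:ℝ) ≤ 4 * N := by exact_mod_cast hm
  have hl := h.hl
  have hNp := h.Npos
  apply h.T_bound x hb hQ (hm.trans h.N4Q) hnd
  · positivity
  · intro u hu1 hu
    have hum : u ≤ m / l := by
      rw [le_div_iff₀ hl]
      have : u * l * (16 * l * (N:ℝ)^2) ≤ m * (16 * l * (N:ℝ)^2) := by
        calc _ = (u * (16 * l * (N:ℝ)^2 * l / m)) * m := by field_simp
          _ ≤ (16 * l * (N:ℝ)^2) * m := by gcongr
          _ = _ := by ring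
      exact le_of_mul_le_mul_right this (by positivity)
    constructor
    · calc u ≤ m / l := hum
        _ ≤ (4 * N) / l := by gcongr
        _ = _ := by ring
    · calc u * (m:ℝ)^2 ≤ (m / l) * (m:ℝ)^2 := by gcongr
        _ ≤ (4 * N / l) * (4 * N)^2 := by gcongr
        _ = _ := by ring
  · have e : 400 / l^2 * (16 * l * (N:ℝ)^2 * l / m) = 400 * (16 * (N:ℝ)^2) / m := by field_simp
    rw [e, le_div_iff₀ (by positivity)]
    have h1 : (m:ℝ)^3 * rho c N m ≤ 200 := by
      unfold rho
      have a1 : (m:ℝ)^3 * dl m ≤ 2 := by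
        have hlm := log_nat_pos hm2
        have : (m:ℝ)^3 * dl m = 1 / Real.log m := by unfold dl; field_simp
        rw [this, div_le_iff₀ hlm]
        have h1 : Real.log 2 ≤ Real.log m := Real.log_le_log (by norm_num) hmR
        have h2 := Real.log_two_gt_d9
        linarith
      have a2 : (m:ℝ)^3 * dl N ≤ 64 := by
        calc (m:ℝ)^3 * dl N ≤ (4 * N)^3 * dl N := by gcongr; exact h.dpos.le
          _ = 64 * (dl N * (N:ℝ)^3) := by ring
          _ ≤ 64 * 1 := by gcongr; linarith [h.d3]
          _ = 64 := by norm_num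
      have : c * ((m:ℝ)^3 * dl m) ≤ 1/10^6 * 2 := by
        have := h.hc1
        have := h.hc
        have := dl_pos hm2
        gcongr
      nlinarith
    calc _ = 2 * (16 * (N:ℝ)^2) * ((m:ℝ)^3 * rho c N m) := by ring
      _ ≤ 2 * (16 * (N:ℝ)^2) * 200 := by gcongr
      _ = _ := by ring

lemma rho_B (h : SH l c q B N) {m : ℕ} (hQ : 4 * N < m) : rho c N m ≤ 4 * dl N := by
  unfold rho
  have h1 : dl m ≤ dl N := dl_anti h.N2 (by omega)
  have := h.hc1
  have := h.hc
  have hd := h.dpos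
  have hN2 := h.N2
  have := dl_pos (show 2 ≤ m by omega)
  have hc1 : c ≤ 1 := by linarith
  have : c * dl m ≤ 1 * dl N := by
    gcongr
  linarith

lemma T_B (h : SH l c q B N) (x : ℝ) {b : ℕ} (hb : b ∈ PB B) {m : ℕ} (hQ : 4 * N < m)
    (hm : m ≤ Qf (dl N)) (hnd : ¬ q * b ∣ m) : 
    ((Tset N x l (q * b) m (rho c N m)).card : ℝ) ≤ 
      1 + 640 * (16 * l * (N:ℝ)^2) * ((m:ℝ)^2 * rho c N m) + (16 * l * (N:ℝ)^2) * l * (m:ℝ)^2 / (N:ℝ)^3 + 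
        (16 * l * (N:ℝ)^2) * Xs q (Wf l N) (Uf l N) (Hf l) b m := by
  have hN2 := h.N2
  have hmN : 4 * (N:ℝ) < m := by exact_mod_cast hQ
  have hl := h.hl
  have hNp := h.Npos
  have hmp : (0:ℝ) < m := by linarith
  apply h.T_bound x hb (by have := h.QlN; omega) hm hnd
  · positivity
  · intro u hu1 hu
    have hum : u * (m:ℝ)^2 ≤ (N:ℝ)^3 / l := by
      rw [le_div_iff₀ hl]
      have : u * (m:ℝ)^2 * l * (16 * l * (N:ℝ)^2) ≤ (N:ℝ)^3 * (16 * l * (N:ℝ)^2) := by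
        calc _ = (u * (16 * l * (N:ℝ)^2 * l * (m:ℝ)^2 / (N:ℝ)^3)) * (N:ℝ)^3 := by field_simp
          _ ≤ (16 * l * (N:ℝ)^2) * (N:ℝ)^3 := by gcongr
          _ = _ := by ring
      exact le_of_mul_le_mul_right this (by positivity)
    constructor
    · have : u * (N:ℝ)^2 ≤ (4 / l * N) * (N:ℝ)^2 := by
        calc u * (N:ℝ)^2 ≤ u * (m:ℝ)^2 := by gcongr; linarith
          _ ≤ (N:ℝ)^3 / l := hum
          _ = (1 / l * N) * (N:ℝ)^2 := by ring
          _ ≤ _ := by gcongr; norm_num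
      exact le_of_mul_le_mul_right this (by positivity)
    · calc _ ≤ (N:ℝ)^3 / l := hum
        _ = 1 / l * (N:ℝ)^3 := by ring
        _ ≤ _ := by gcongr; norm_num
  · have e : 400 / l^2 * (16 * l * (N:ℝ)^2 * l * (m:ℝ)^2 / (N:ℝ)^3) = 400 * (16 * (N:ℝ)^2) * (m:ℝ)^2 / (N:ℝ)^3 := by field_simp
    rw [e, le_div_iff₀ (by positivity)]
    have h1 := h.rho_B hQ
    have h2 := h.d3
    calc 2 * (16 * (N:ℝ)^2 * (m:ℝ)^2 * rho c N m) * (N:ℝ)^3 ≤ 2 * (16 * (N:ℝ)^2 * (m:ℝ)^2 * (4 * dl N)) * (N:ℝ)^3 := by gcongr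
      _ = 2 * (16 * (N:ℝ)^2 * (m:ℝ)^2 * 4) * (dl N * (N:ℝ)^3) := by ring
      _ ≤ 2 * (16 * (N:ℝ)^2 * (m:ℝ)^2 * 4) * 1 := by gcongr; linarith
      _ ≤ _ := by nlinarith [show 0 < (N:ℝ)^2 * (m:ℝ)^2 by positivity]
end SH


lemma Xs_nonneg (q W U H b m : ℕ) : 0 ≤ Xs q W U H b m := by
  unfold Xs
  apply Finset.sum_nonneg; intro u _
  apply Finset.sum_nonneg; intro h _
  split_ifs <;> positivity

namespace SH
variable {l c : ℝ} {q B N : ℕ}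

lemma lN (h : SH l c q B N) : 1000 ≤ l * N := by
  have h1 := h.NG
  have h3 := h.hl
  have := mul_le_mul_of_nonneg_right h1 h3.le
  have e : 1000 * (1/l) * l = 1000 := by field_simp
  linarith

lemma exc (h : SH l c q B N) (Ms : Finset ℕ) :
    ∑ b ∈ PB B, ∑ m ∈ Ms, wv (4 * N) m * Xs q (Wf l N) (Uf l N) (Hf l) b m ≤ (PB B).card / 1000 := by
  have hl := h.hl
  have hNp := h.Npos
  refine le_trans (excess_bound q h.hq h.hq2 (Wf l N) (Uf l N) (Hf l) B (4 * N) (by positivity) ?_ h.Bpos ?_ ?_ (PB B) ?_ Ms) h.hExc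
  · have : ((Hf l : ℕ):ℝ) < q := lt_of_le_of_lt (Nat.floor_le (by positivity)) h.hH
    exact_mod_cast this
  · have a1 : ((Hf l : ℕ):ℝ) ≤ _ := Nat.floor_le (by positivity)
    have a2 : ((Wf l N : ℕ):ℝ) ≤ _ := Nat.floor_le (by positivity)
    have a3 : ((Wf l N : ℕ):ℝ) + Hf l < (q:ℝ)^2 * (B:ℝ)^4 := lt_of_le_of_lt (add_le_add a2 a1) h.hW
    exact_mod_cast a3
  · have a3 : ((Uf l N : ℕ):ℝ) < (B:ℝ)^2 := lt_of_le_of_lt (Nat.floor_le (by positivity)) h.hU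
    exact_mod_cast a3
  · intro b hb
    exact (h.nb hb).2.2

lemma sumA (h : SH l c q B N) (x : ℝ) :
    ∑ b ∈ PB B, ∑ m ∈ (Finset.Ioc (Qf l) (4 * N)).filter (fun m => ¬ q * b ∣ m), 
      ((Tset N x l (q * b) m (rho c N m)).card : ℝ) ≤ 5 / 1000 * ((PB B).card * (16 * l * (N:ℝ)^2)) := by
  have hl := h.hl
  have hNp := h.Npos
  have hc := h.hc
  have hd := h.dpos
  have hQ2 := h.hQ2
  set P := 16 * l * (N:ℝ)^2 with hP
  have hPp : 0 < P := by positivity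
  have hrho : ∀ m ∈ Finset.Ioc (Qf l) (4 * N), (m:ℝ)^2 * rho c N m ≤ c * (1 / ((m:ℝ) * Real.log m)) + 48 * dl N * (N:ℝ)^2 := by
    intro m hm
    rw [Finset.mem_Ioc] at hm
    rw [← m2dl (by omega)]
    unfold rho
    have : (m:ℝ) ≤ 4 * N := by exact_mod_cast hm.2
    have : dl N * (m:ℝ)^2 ≤ dl N * (4 * N)^2 := by gcongr
    nlinarith
  have hrho0 : ∀ m ∈ Finset.Ioc (Qf l) (4 * N), 0 ≤ rho c N m := by
    intro m hm
    rw [Finset.mem_Ioc] at hm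
    have := dl_pos (show 2 ≤ m by omega)
    unfold rho
    positivity
  have hX := fun b m => Xs_nonneg q (Wf l N) (Uf l N) (Hf l) b m
  have step1 : ∀ b ∈ PB B, ∑ m ∈ (Finset.Ioc (Qf l) (4 * N)).filter (fun m => ¬ q * b ∣ m), 
      ((Tset N x l (q * b) m (rho c N m)).card : ℝ) ≤ 
      4 / 1000 * P + P * ∑ m ∈ Finset.Ioc (Qf l) (4 * N), wv (4 * N) m * Xs q (Wf l N) (Uf l N) (Hf l) b m := by
    intro b hb
    have s1 : ∑ m ∈ (Finset.Ioc (Qf l) (4 * N)).filter (fun m => ¬ q * b ∣ m), 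
      ((Tset N x l (q * b) m (rho c N m)).card : ℝ) ≤ ∑ m ∈ Finset.Ioc (Qf l) (4 * N), 
        (1 + 640 * P * ((m:ℝ)^2 * rho c N m) + P * l / m + P * Xs q (Wf l N) (Uf l N) (Hf l) b m) := by
      calc _ ≤ ∑ m ∈ (Finset.Ioc (Qf l) (4 * N)).filter (fun m => ¬ q * b ∣ m), 
            (1 + 640 * P * ((m:ℝ)^2 * rho c N m) + P * l / m + P * Xs q (Wf l N) (Uf l N) (Hf l) b m) := by
            apply Finset.sum_le_sum
            intro m hm
            rw [Finset.mem_filter, Finset.mem_Ioc] at hm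
            exact h.T_A x hb hm.1.1 hm.1.2 hm.2
        _ ≤ _ := by
            apply Finset.sum_le_sum_of_subset_of_nonneg (Finset.filter_subset _ _)
            intro m hm _
            have := hrho0 m hm
            have := hX b m
            positivity
    refine s1.trans ?_
    rw [Finset.sum_add_distrib, Finset.sum_add_distrib, Finset.sum_add_distrib]
    have t1 : ∑ m ∈ Finset.Ioc (Qf l) (4 * N), (1:ℝ) ≤ 1/1000 * P := by
      rw [Finset.sum_const, nsmul_eq_mul, mul_one, Nat.card_Ioc]
      calc ((4 * N - Qf l : ℕ):ℝ) ≤ ((4 * N : ℕ):ℝ) := by exact_mod_cast Nat.sub_le _ _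
        _ = 4 * N := by push_cast; ring
        _ ≤ _ := by rw [hP]; nlinarith [h.lN]
    have t2 : ∑ m ∈ Finset.Ioc (Qf l) (4 * N), 640 * P * ((m:ℝ)^2 * rho c N m) ≤ 2/1000 * P := by
      rw [← Finset.mul_sum]
      have := Finset.sum_le_sum hrho
      rw [Finset.sum_add_distrib, ← Finset.mul_sum, Finset.sum_const, nsmul_eq_mul, Nat.card_Ioc] at this
      have h1 := h.hLam
      have h2 : ((4 * N - Qf l : ℕ):ℝ) * (48 * dl N * (N:ℝ)^2) ≤ 192 * (dl N * (N:ℝ)^3) := by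
        calc _ ≤ ((4 * N : ℕ):ℝ) * (48 * dl N * (N:ℝ)^2) := by gcongr; exact Nat.sub_le _ _
          _ = _ := by push_cast; ring
      have h3 := h.d3
      have h4 : 640 * ∑ m ∈ Finset.Ioc (Qf l) (4 * N), ((m:ℝ)^2 * rho c N m) ≤ 2/1000 := by
        have : (640:ℝ) * (192 * (dl N * (N:ℝ)^3)) ≤ 1/1000 := by linarith
        nlinarith
      nlinarith
    have t3 : ∑ m ∈ Finset.Ioc (Qf l) (4 * N), P * l / m ≤ 1/1000 * P := by
      have e : ∀ m ∈ Finset.Ioc (Qf l) (4 * N), P * l / (m:ℝ) = P * l * (1 / (m:ℝ)) := fun m _ => by ring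
      rw [Finset.sum_congr rfl e, ← Finset.mul_sum]
      have h1 : ∑ m ∈ Finset.Ioc (Qf l) (4 * N), 1 / (m:ℝ) ≤ 1 + Real.log (4 * N) := by
        have := sum_inv_Icc (4 * N)
        push_cast at this
        refine le_trans (Finset.sum_le_sum_of_subset_of_nonneg ?_ (fun _ _ _ => by positivity)) this
        intro m hm
        rw [Finset.mem_Ioc] at hm
        rw [Finset.mem_Icc]; omega
      calc P * l * ∑ m ∈ Finset.Ioc (Qf l) (4 * N), 1 / (m:ℝ) ≤ P * l * (1 / (1000 * l)) := by
            gcongr; exact h1.trans h.hG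
        _ = _ := by field_simp
    have t4 : ∑ m ∈ Finset.Ioc (Qf l) (4 * N), P * Xs q (Wf l N) (Uf l N) (Hf l) b m = 
        P * ∑ m ∈ Finset.Ioc (Qf l) (4 * N), wv (4 * N) m * Xs q (Wf l N) (Uf l N) (Hf l) b m := by
      rw [← Finset.mul_sum]
      congr 1
      apply Finset.sum_congr rfl
      intro m hm
      rw [Finset.mem_Ioc] at hm
      have hm0 : (0:ℝ) < m := by exact_mod_cast (by omega : 0 < m)
      have : wv (4 * N) m = 1 := by
        unfold wv
        apply min_eq_left
        have : 1 ≤ 4 * (N:ℝ) / m := by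
          rw [le_div_iff₀ hm0]; rw [one_mul]; exact_mod_cast hm.2
        nlinarith
      rw [this, one_mul]
    rw [t4]
    linarith
  refine (Finset.sum_le_sum step1).trans ?_
  rw [Finset.sum_add_distrib, Finset.sum_const, nsmul_eq_mul, ← Finset.mul_sum]
  have := h.exc (Finset.Ioc (Qf l) (4 * N))
  nlinarith

lemma Q'le (h : SH l c q B N) : Qf (dl N) ≤ N^2 := by
  have hd := h.dpos
  have h1 := (le_Qf hd (Qf (dl N))).1 le_rfl
  have h2 := h.dmul
  have h3 := Real.log_le_self h.Npos.le
  have hNp := h.Npos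
  have h4 : 1 ≤ dl N * (N:ℝ)^4 := by
    calc 1 = dl N * ((N:ℝ)^3 * Real.log N) := h2.symm
      _ ≤ dl N * ((N:ℝ)^3 * N) := by gcongr
      _ = _ := by ring
  by_contra hcon
  push Not at hcon
  have h5 : (N:ℝ)^2 ≤ Qf (dl N) := by exact_mod_cast hcon.le
  have h6 : dl N * (N:ℝ)^4 ≤ dl N * (Qf (dl N):ℝ)^2 := by
    calc dl N * (N:ℝ)^4 = dl N * ((N:ℝ)^2)^2 := by ring
      _ ≤ _ := by gcongr
  nlinarith

lemma logQ' (h : SH l c q B N) : Real.log (Qf (dl N)) ≤ 2 * Real.log N := by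
  have h1 := h.Q'le
  have h2 := h.N4Q
  have h3 := h.N2
  rw [show 2 * Real.log N = Real.log ((N:ℝ)^2) by rw [Real.log_pow]; norm_num]
  apply Real.log_le_log
  · exact_mod_cast (by omega : 0 < Qf (dl N))
  · exact_mod_cast h1

lemma sumB (h : SH l c q B N) (x : ℝ) :
    ∑ b ∈ PB B, ∑ m ∈ (Finset.Ioc (4 * N) (Qf (dl N))).filter (fun m => ¬ q * b ∣ m), 
      ((Tset N x l (q * b) m (rho c N m)).card : ℝ) * dl m ≤ 2600 * dl N * ((PB B).card * (16 * l * (N:ℝ)^2)) := by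
  have hl := h.hl
  have hNp := h.Npos
  have hc := h.hc
  have hd := h.dpos
  have hN2 := h.N2
  set P := 16 * l * (N:ℝ)^2 with hP
  have hPp : 0 < P := by positivity
  have hL0 : 0 < Real.log N := by linarith [h.hL]
  have hm_facts : ∀ m ∈ Finset.Ioc (4 * N) (Qf (dl N)), 2 ≤ m ∧ 4 * (N:ℝ) < m ∧ 0 < dl m ∧ (m:ℝ)^3 * dl m ≤ dl N * (N:ℝ)^3 := by
    intro m hm
    rw [Finset.mem_Ioc] at hm
    have hm2 : 2 ≤ m := by omega
    refine ⟨hm2, by exact_mod_cast hm.1, dl_pos hm2, ?_⟩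
    have e1 : (m:ℝ)^3 * dl m = 1 / Real.log m := by
      have := log_nat_pos hm2
      unfold dl; field_simp
    have e2 : dl N * (N:ℝ)^3 = 1 / Real.log N := by
      unfold dl; field_simp
    rw [e1, e2]
    apply one_div_le_one_div_of_le hL0
    apply Real.log_le_log hNp
    exact_mod_cast (by omega : N ≤ m)
  have hX := fun b m => Xs_nonneg q (Wf l N) (Uf l N) (Hf l) b m
  have hterm : ∀ b ∈ PB B, ∀ m ∈ Finset.Ioc (4 * N) (Qf (dl N)), ¬ q * b ∣ m → 
      ((Tset N x l (q * b) m (rho c N m)).card : ℝ) * dl m ≤ dl N * ((N:ℝ)^2 * ((m:ℝ)^2)⁻¹ + 2560 * P * (1 / ((m:ℝ) * Real.log m)) + P * l * (1 / (m:ℝ)) + P * (wv (4 * N) m * Xs q (Wf l N) (Uf l N) (Hf l) b m)) := by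
    intro b hb m hm hnd
    obtain ⟨f1, f2, f3, f4⟩ := hm_facts m hm
    rw [Finset.mem_Ioc] at hm
    have hm0 : (0:ℝ) < m := by linarith
    have hT := h.T_B x hb hm.1 hm.2 hnd
    rw [← hP] at hT
    have r1 := h.rho_B hm.1
    have g1 : 1 * dl m ≤ dl N * ((N:ℝ)^2 * ((m:ℝ)^2)⁻¹) := by
      rw [← mul_assoc, ← div_eq_mul_inv, le_div_iff₀ (by positivity)]
      have : (m:ℝ) * (1 * dl m * (m:ℝ)^2) ≤ m * (dl N * (N:ℝ)^2) := by
        calc _ = (m:ℝ)^3 * dl m := by ring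
          _ ≤ dl N * (N:ℝ)^3 := f4
          _ = N * (dl N * (N:ℝ)^2) := by ring
          _ ≤ _ := by gcongr; linarith
      exact le_of_mul_le_mul_left this hm0
    have g2 : (640 * P * ((m:ℝ)^2 * rho c N m)) * dl m ≤ dl N * (2560 * P * (1 / ((m:ℝ) * Real.log m))) := by
      rw [← m2dl f1]
      calc _ ≤ (640 * P * ((m:ℝ)^2 * (4 * dl N))) * dl m := by gcongr
        _ = _ := by ring
    have g3 : (P * l * (m:ℝ)^2 / (N:ℝ)^3) * dl m ≤ dl N * (P * l * (1 / (m:ℝ))) := by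
      have : (P * l * (m:ℝ)^2 / (N:ℝ)^3) * dl m = P * l * (1 / m) * (((m:ℝ)^3 * dl m) / (N:ℝ)^3) := by
        field_simp
      rw [this]
      have h2 : ((m:ℝ)^3 * dl m) / (N:ℝ)^3 ≤ dl N := by
        rw [div_le_iff₀ (by positivity)]; exact f4
      calc _ ≤ P * l * (1 / m) * dl N := by gcongr
        _ = _ := by ring
    have g4 : (P * Xs q (Wf l N) (Uf l N) (Hf l) b m) * dl m ≤ dl N * (P * (wv (4 * N) m * Xs q (Wf l N) (Uf l N) (Hf l) b m)) := by
      have hw : dl m ≤ dl N * wv (4 * N) m := by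
        unfold wv
        rw [mul_min_of_nonneg _ _ hd.le, le_min_iff]
        refine ⟨by rw [mul_one]; exact dl_anti hN2 (by omega), ?_⟩
        calc dl m = 1 * dl m := (one_mul _).symm
          _ ≤ _ := g1
          _ ≤ _ := by
            gcongr
            rw [div_pow, div_eq_mul_inv]
            gcongr
            linarith
      have := hX b m
      calc _ ≤ (P * Xs q (Wf l N) (Uf l N) (Hf l) b m) * (dl N * wv (4 * N) m) := by gcongr
        _ = _ := by ring
    calc _ ≤ _ := mul_le_mul_of_nonneg_right hT f3.le
      _ = 1 * dl m + (640 * P * ((m:ℝ)^2 * rho c N m)) * dl m + (P * l * (m:ℝ)^2 / (N:ℝ)^3) * dl m + (P * Xs q (Wf l N) (Uf l N) (Hf l) b m) * dl m := by ring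
      _ ≤ _ := by linarith
  have step1 : ∀ b ∈ PB B, ∑ m ∈ (Finset.Ioc (4 * N) (Qf (dl N))).filter (fun m => ¬ q * b ∣ m), 
      ((Tset N x l (q * b) m (rho c N m)).card : ℝ) * dl m ≤ 
      dl N * (2562 * P + P * ∑ m ∈ Finset.Ioc (4 * N) (Qf (dl N)), wv (4 * N) m * Xs q (Wf l N) (Uf l N) (Hf l) b m) := by
    intro b hb
    have s1 : ∑ m ∈ (Finset.Ioc (4 * N) (Qf (dl N))).filter (fun m => ¬ q * b ∣ m), 
      ((Tset N x l (q * b) m (rho c N m)).card : ℝ) * dl m ≤ ∑ m ∈ Finset.Ioc (4 * N) (Qf (dl N)), 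
        dl N * ((N:ℝ)^2 * ((m:ℝ)^2)⁻¹ + 2560 * P * (1 / ((m:ℝ) * Real.log m)) + P * l * (1 / (m:ℝ)) + P * (wv (4 * N) m * Xs q (Wf l N) (Uf l N) (Hf l) b m)) := by
      calc _ ≤ ∑ m ∈ (Finset.Ioc (4 * N) (Qf (dl N))).filter (fun m => ¬ q * b ∣ m), 
            dl N * ((N:ℝ)^2 * ((m:ℝ)^2)⁻¹ + 2560 * P * (1 / ((m:ℝ) * Real.log m)) + P * l * (1 / (m:ℝ)) + P * (wv (4 * N) m * Xs q (Wf l N) (Uf l N) (Hf l) b m)) := by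
            apply Finset.sum_le_sum
            intro m hm
            rw [Finset.mem_filter] at hm
            exact hterm b hb m hm.1 hm.2
        _ ≤ _ := by
            apply Finset.sum_le_sum_of_subset_of_nonneg (Finset.filter_subset _ _)
            intro m hm _
            obtain ⟨f1, f2, f3, f4⟩ := hm_facts m hm
            have := log_nat_pos f1
            have := hX b m
            have := wv_nonneg (4 * N) m
            positivity
    refine s1.trans ?_
    rw [← Finset.mul_sum]
    gcongr
    rw [Finset.sum_add_distrib, Finset.sum_add_distrib, Finset.sum_add_distrib, ← Finset.mul_sum, ← Finset.mul_sum, ← Finset.mul_sum, ← Finset.mul_sum]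
    have t1 : (N:ℝ)^2 * ∑ m ∈ Finset.Ioc (4 * N) (Qf (dl N)), ((m:ℝ)^2)⁻¹ ≤ P := by
      have h1 := sum_Ioc_inv_sq_le_sub (α := ℝ) (k := 4 * N) (n := Qf (dl N)) (by omega) h.N4Q
      have h2 : (0:ℝ) ≤ ((Qf (dl N) : ℕ) : ℝ)⁻¹ := by positivity
      have h3 : ∑ m ∈ Finset.Ioc (4 * N) (Qf (dl N)), ((m:ℝ)^2)⁻¹ ≤ (N:ℝ)⁻¹ := by
        have : (((4 * N : ℕ)):ℝ)⁻¹ ≤ (N:ℝ)⁻¹ := by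
          apply inv_anti₀ hNp
          push_cast; linarith
        linarith
      calc _ ≤ (N:ℝ)^2 * (N:ℝ)⁻¹ := by gcongr
        _ = N := by field_simp
        _ ≤ P := by rw [hP]; nlinarith [h.lN]
    have t2 : ∑ m ∈ Finset.Ioc (4 * N) (Qf (dl N)), 1 / ((m:ℝ) * Real.log m) ≤ 1 := by
      refine (sum_inv_mlog (4 * N) (Qf (dl N)) (by omega) h.N4Q).trans ?_
      have h1 : Real.log N ≤ Real.log ((4 * N : ℕ):ℝ) := by
        apply Real.log_le_log hNp; push_cast; linarith
      have h2 := h.logQ'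
      have h3 : 0 < Real.log ((4 * N : ℕ):ℝ) := by linarith
      have h4 : 0 < Real.log (Qf (dl N) : ℝ) := log_nat_pos (by have := h.N4Q; omega)
      have := Real.log_le_sub_one_of_pos (div_pos h4 h3)
      have h5 : Real.log (Qf (dl N)) / Real.log ((4 * N : ℕ):ℝ) ≤ 2 := by
        rw [div_le_iff₀ h3]; linarith
      linarith
    have t3 : l * ∑ m ∈ Finset.Ioc (4 * N) (Qf (dl N)), 1 / (m:ℝ) ≤ 1 := by
      have h1 : ∑ m ∈ Finset.Ioc (4 * N) (Qf (dl N)), 1 / (m:ℝ) ≤ 1 + Real.log (Qf (dl N)) := by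
        refine le_trans (Finset.sum_le_sum_of_subset_of_nonneg ?_ (fun _ _ _ => by positivity)) (sum_inv_Icc _)
        intro m hm
        rw [Finset.mem_Ioc] at hm
        rw [Finset.mem_Icc]; omega
      have h2 := h.logQ'
      have h3 := h.hG
      have h4 : Real.log N ≤ Real.log (4 * N) := Real.log_le_log hNp (by linarith)
      calc _ ≤ l * (2 * (1 / (1000 * l))) := by gcongr; linarith
        _ = 2 / 1000 := by field_simp
        _ ≤ 1 := by norm_num
    nlinarith
  refine (Finset.sum_le_sum step1).trans ?_
  rw [← Finset.mul_sum, Finset.sum_add_distrib, Finset.sum_const, nsmul_eq_mul, ← Finset.mul_sum, mul_comm 2600 (dl N), mul_assoc (dl N) 2600]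
  apply mul_le_mul_of_nonneg_left _ hd.le
  have h3 := h.exc (Finset.Ioc (4 * N) (Qf (dl N)))
  have h2 : (0:ℝ) ≤ (PB B).card := by positivity
  have h4 := mul_le_mul_of_nonneg_left h3 hPp.le
  nlinarith [mul_nonneg h2 hPp.le]
end SH


lemma int_near_card (s : Finset ℤ) (n : ℕ) (hn : 0 < n) (t r : ℝ) (hr : 0 ≤ r) :
    ((s.filter (fun p : ℤ => |(p:ℝ) / (n:ℝ)^2 - t| ≤ r)).card : ℝ) ≤ 1 + 2 * r * (n:ℝ)^2 := by
  have hn2 : (0:ℝ) < (n:ℝ)^2 := by positivity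
  apply card_sep _ (fun p : ℤ => (p:ℝ)) _ (by positivity)
  · intro x _ y _ hxy
    have : 1 ≤ |x - y| := Int.one_le_abs (sub_ne_zero.mpr hxy)
    exact_mod_cast this
  · intro x hx y hy
    rw [Finset.mem_filter, abs_le] at hx hy
    have h1 : (x:ℝ) / (n:ℝ)^2 ≤ t + r := by linarith [hx.2.2]
    have h2 : t - r ≤ (y:ℝ) / (n:ℝ)^2 := by linarith [hy.2.1]
    rw [div_le_iff₀ hn2] at h1
    rw [le_div_iff₀ hn2] at h2
    linarith

namespace SH
variable {l c : ℝ} {q B N : ℕ}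

/-- facts for small m -/
lemma smallm (h : SH l c q B N) {m : ℕ} (hm : 2 ≤ m) (hQ : m ≤ Qf l) : 
    1 ≤ c * dl m * (N:ℝ)^2 ∧ 3 * dl N ≤ c * dl m := by
  have hl := h.hl
  have hc := h.hc
  have hNp := h.Npos
  rw [le_Qf hl] at hQ
  have hm0 : (0:ℝ) < m := by positivity
  have hdl : 1 / (m:ℝ)^4 ≤ dl m := by
    unfold dl
    have h1 := log_nat_pos hm
    apply one_div_le_one_div_of_le (by positivity)
    have : Real.log m ≤ m := Real.log_le_self hm0.le
    calc _ ≤ (m:ℝ)^3 * m := by gcongr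
      _ = _ := by ring
  have h2 : l^2 ≤ 1 / (m:ℝ)^4 := by
    rw [le_div_iff₀ (by positivity)]
    have h3 : l * (m:ℝ)^2 ≤ 1 := by nlinarith [mul_pos hl (pow_pos hm0 2)]
    calc l^2 * (m:ℝ)^4 = (l * (m:ℝ)^2)^2 := by ring
      _ ≤ 1 := pow_le_one₀ (by positivity) h3
  have h3 := h.hGN
  rw [div_le_iff₀ (by positivity)] at h3
  have h4 : 1 ≤ c * dl m * (N:ℝ)^2 := by
    calc (1:ℝ) ≤ c * (N:ℝ)^2 * l^2 := by linarith
      _ ≤ c * (N:ℝ)^2 * dl m := by gcongr; linarith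
      _ = _ := by ring
  refine ⟨h4, ?_⟩
  have h5 := h.d2
  have : 3 * dl N * (N:ℝ)^2 ≤ c * dl m * (N:ℝ)^2 := by nlinarith
  exact le_of_mul_le_mul_right this (by positivity)

open scoped Classical in
lemma k1 (h : SH l c q B N) {x A : ℝ} {S : ℕ} (hS : 2 ≤ S) (hF : Fut x l S (Qf l) ≤ A * l) {b : ℕ} (hb : b ∈ PB B) :
    (((cand N x l (q * b)).filter (fun p : ℤ => ∃ m ∈ Finset.Ioc S (Qf l), ∃ p' : ℤ, 
      |(p:ℝ) / ((q * b : ℕ):ℝ)^2 - (p':ℝ) / (m:ℝ)^2| ≤ rho c N m)).card : ℝ) ≤ 65 * c * (N:ℝ)^2 * (A * l) := by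
  have hl := h.hl
  have hc := h.hc
  have hNp := h.Npos
  have hd := h.dpos
  obtain ⟨n1, n2, _, _, _⟩ := h.nb hb
  have hn : 0 < q * b := by omega
  set n := q * b with hn_def
  have hn4 : (n:ℝ) ≤ 4 * N := by exact_mod_cast n2
  have hsub : (cand N x l n).filter (fun p : ℤ => ∃ m ∈ Finset.Ioc S (Qf l), ∃ p' : ℤ, 
      |(p:ℝ) / (n:ℝ)^2 - (p':ℝ) / (m:ℝ)^2| ≤ rho c N m) ⊆ 
      (Finset.Ioc S (Qf l)).biUnion (fun m => (rset m x l).biUnion (fun p' => 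
        (cand N x l n).filter (fun p : ℤ => |(p:ℝ) / (n:ℝ)^2 - (p':ℝ) / (m:ℝ)^2| ≤ rho c N m))) := by
    intro p hp
    rw [Finset.mem_filter] at hp
    obtain ⟨hp, m, hm, p', hp'⟩ := hp
    rw [Finset.mem_biUnion]
    refine ⟨m, hm, ?_⟩
    rw [Finset.mem_biUnion]
    refine ⟨p', ?_, by rw [Finset.mem_filter]; exact ⟨hp, hp'⟩⟩
    rw [Finset.mem_Ioc] at hm
    rw [mem_rset (by omega)]
    rw [mem_cand hn] at hp
    obtain ⟨s1, s2⟩ := h.smallm (show 2 ≤ m by omega) hm.2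
    have hdm := dl_pos (show 2 ≤ m by omega)
    have hr : rho c N m ≤ dl m := by
      unfold rho
      have := h.hc1
      nlinarith
    rw [abs_le] at hp'
    constructor <;> linarith [hp'.1, hp'.2, hp.1, hp.2]
  calc _ ≤ (((Finset.Ioc S (Qf l)).biUnion (fun m => (rset m x l).biUnion (fun p' => 
        (cand N x l n).filter (fun p : ℤ => |(p:ℝ) / (n:ℝ)^2 - (p':ℝ) / (m:ℝ)^2| ≤ rho c N m)))).card : ℝ) := by
        exact_mod_cast Finset.card_le_card hsub
    _ ≤ ∑ m ∈ Finset.Ioc S (Qf l), (((rset m x l).biUnion (fun p' => 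
        (cand N x l n).filter (fun p : ℤ => |(p:ℝ) / (n:ℝ)^2 - (p':ℝ) / (m:ℝ)^2| ≤ rho c N m))).card : ℝ) := by
        exact_mod_cast Finset.card_biUnion_le
    _ ≤ ∑ m ∈ Finset.Ioc S (Qf l), ∑ p' ∈ rset m x l, (((cand N x l n).filter (fun p : ℤ => |(p:ℝ) / (n:ℝ)^2 - (p':ℝ) / (m:ℝ)^2| ≤ rho c N m)).card : ℝ) := by
        apply Finset.sum_le_sum
        intro m _
        exact_mod_cast Finset.card_biUnion_le
    _ ≤ ∑ m ∈ Finset.Ioc S (Qf l), ∑ p' ∈ rset m x l, (65 * c * (N:ℝ)^2 * dl m) := by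
        apply Finset.sum_le_sum
        intro m hm
        apply Finset.sum_le_sum
        intro p' _
        rw [Finset.mem_Ioc] at hm
        obtain ⟨s1, s2⟩ := h.smallm (show 2 ≤ m by omega) hm.2
        have hdm := dl_pos (show 2 ≤ m by omega)
        have hr0 : 0 ≤ rho c N m := by unfold rho; positivity
        have hr : rho c N m ≤ 2 * (c * dl m) := by unfold rho; linarith
        refine (int_near_card _ n hn _ _ hr0).trans ?_
        have : 2 * rho c N m * (n:ℝ)^2 ≤ 2 * (2 * (c * dl m)) * (4 * N)^2 := by gcongr
        nlinarith
    _ = 65 * c * (N:ℝ)^2 * Fut x l S (Qf l) := by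
        unfold Fut
        rw [Finset.mul_sum]
        apply Finset.sum_congr rfl
        intro m _
        rw [Finset.sum_const, nsmul_eq_mul]; ring
    _ ≤ _ := by gcongr

open scoped Classical in
lemma k2 (h : SH l c q B N) (x : ℝ) {b : ℕ} (hb : b ∈ PB B) :
    (((cand N x l (q * b)).filter (fun p : ℤ => ∃ m ∈ (Finset.Ioc (Qf l) (4 * N)).filter (fun m => ¬ q * b ∣ m), ∃ p' : ℤ, 
      |(p:ℝ) / ((q * b : ℕ):ℝ)^2 - (p':ℝ) / (m:ℝ)^2| ≤ rho c N m)).card : ℝ) ≤ 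
    ∑ m ∈ (Finset.Ioc (Qf l) (4 * N)).filter (fun m => ¬ q * b ∣ m), ((Tset N x l (q * b) m (rho c N m)).card : ℝ) := by
  have hd := h.dpos
  obtain ⟨n1, n2, _, _, _⟩ := h.nb hb
  have hn : 0 < q * b := by omega
  have hsub : (cand N x l (q * b)).filter (fun p : ℤ => ∃ m ∈ (Finset.Ioc (Qf l) (4 * N)).filter (fun m => ¬ q * b ∣ m), ∃ p' : ℤ, 
      |(p:ℝ) / ((q * b : ℕ):ℝ)^2 - (p':ℝ) / (m:ℝ)^2| ≤ rho c N m) ⊆ 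
      ((Finset.Ioc (Qf l) (4 * N)).filter (fun m => ¬ q * b ∣ m)).biUnion (fun m => (Tset N x l (q * b) m (rho c N m)).image Prod.fst) := by
    intro p hp
    rw [Finset.mem_filter] at hp
    obtain ⟨hp, m, hm, p', hp'⟩ := hp
    rw [Finset.mem_biUnion]
    refine ⟨m, hm, ?_⟩
    rw [Finset.mem_filter, Finset.mem_Ioc] at hm
    rw [Finset.mem_image]
    exact ⟨(p, p'), (mem_Tset hd.le hn (by omega)).mpr ⟨hp, hp'⟩, rfl⟩
  have h1 := (Finset.card_le_card hsub).trans Finset.card_biUnion_le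
  have h2 := h1.trans (Finset.sum_le_sum (fun m _ => Finset.card_image_le))
  exact_mod_cast h2

lemma k3 (h : SH l c q B N) (x : ℝ) {A : ℝ} {b : ℕ} (hb : b ∈ PB B) :
    A * dl N * (((cand N x l (q * b)).filter (fun p : ℤ => 
      A * dl N < Fut ((p:ℝ) / ((q * b : ℕ):ℝ)^2 + dl N) (dl N) (4 * N) (Qf (dl N)))).card : ℝ) ≤ 
    ∑ m ∈ (Finset.Ioc (4 * N) (Qf (dl N))).filter (fun m => ¬ q * b ∣ m), ((Tset N x l (q * b) m (rho c N m)).card : ℝ) * dl m := by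
  have hd := h.dpos
  have hc := h.hc
  obtain ⟨n1, n2, _, _, _⟩ := h.nb hb
  have hn : 0 < q * b := by omega
  set n := q * b with hn_def
  have hnr : (0:ℝ) < n := by exact_mod_cast hn
  set F : ℤ → ℝ := fun p => Fut ((p:ℝ) / (n:ℝ)^2 + dl N) (dl N) (4 * N) (Qf (dl N)) with hFdef
  have hF0 : ∀ p, 0 ≤ F p := by
    intro p
    apply Finset.sum_nonneg
    intro m hm
    rw [Finset.mem_Ioc] at hm
    have := dl_pos (show 2 ≤ m by omega)
    positivity
  have e1 : A * dl N * (((cand N x l n).filter (fun p : ℤ => A * dl N < F p)).card : ℝ) ≤ ∑ p ∈ cand N x l n, F p := by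
    calc _ = ∑ p ∈ (cand N x l n).filter (fun p : ℤ => A * dl N < F p), A * dl N := by
          rw [Finset.sum_const, nsmul_eq_mul]; ring
      _ ≤ ∑ p ∈ (cand N x l n).filter (fun p : ℤ => A * dl N < F p), F p := by
          apply Finset.sum_le_sum
          intro p hp
          exact (Finset.mem_filter.mp hp).2.le
      _ ≤ _ := Finset.sum_le_sum_of_subset_of_nonneg (Finset.filter_subset _ _) (fun p _ _ => hF0 p)
  refine e1.trans ?_
  have e2 : ∑ p ∈ cand N x l n, F p = ∑ m ∈ Finset.Ioc (4 * N) (Qf (dl N)), 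
      (∑ p ∈ cand N x l n, ((rset m ((p:ℝ) / (n:ℝ)^2 + dl N) (dl N)).card : ℝ)) * dl m := by
    simp only [hFdef, Fut]
    rw [Finset.sum_comm]
    apply Finset.sum_congr rfl
    intro m _
    rw [Finset.sum_mul]
  rw [e2]
  rw [← Finset.sum_filter_add_sum_filter_not (Finset.Ioc (4 * N) (Qf (dl N))) (fun m => ¬ n ∣ m)]
  have e3 : ∑ m ∈ (Finset.Ioc (4 * N) (Qf (dl N))).filter (fun m => ¬ ¬ n ∣ m), 
      (∑ p ∈ cand N x l n, ((rset m ((p:ℝ) / (n:ℝ)^2 + dl N) (dl N)).card : ℝ)) * dl m = 0 := by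
    apply Finset.sum_eq_zero
    intro m hm
    rw [Finset.mem_filter, Finset.mem_Ioc, not_not] at hm
    obtain ⟨⟨m1, m2⟩, j, hj⟩ := hm
    have : ∑ p ∈ cand N x l n, ((rset m ((p:ℝ) / (n:ℝ)^2 + dl N) (dl N)).card : ℝ) = 0 := by
      apply Finset.sum_eq_zero
      intro p _
      rw [Nat.cast_eq_zero, Finset.card_eq_zero, Finset.eq_empty_iff_forall_notMem]
      intro p' hp'
      rw [mem_rset (by omega)] at hp'
      have hm0 : (0:ℝ) < m := by exact_mod_cast (show 0 < m by omega)
      have hm2 : (0:ℝ) < (m:ℝ)^2 := by positivity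
      have hj0 : (0:ℝ) < j := by
        rcases Nat.eq_zero_or_pos j with h0 | h0
        · subst h0; omega
        · exact_mod_cast h0
      have hdm : dl m < dl N := by
        unfold dl
        have hNp := h.Npos
        have hlN : 0 < Real.log N := log_nat_pos h.N2
        have hNm : (N:ℝ) < m := by exact_mod_cast (show N < m by omega)
        apply one_div_lt_one_div_of_lt (by positivity)
        have : Real.log N ≤ Real.log m := Real.log_le_log hNp hNm.le
        calc _ < (m:ℝ)^3 * Real.log N := by gcongr
          _ ≤ _ := by gcongr
      have hdm0 := dl_pos (show 2 ≤ m by omega)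
      rw [le_Qf hd] at m2
      have hy : (p:ℝ) / (n:ℝ)^2 = ((p * (j:ℤ)^2 : ℤ):ℝ) / (m:ℝ)^2 := by
        rw [hj]; push_cast; field_simp
      rw [hy] at hp'
      obtain ⟨q1, q2⟩ := hp'
      set z : ℤ := p * (j:ℤ)^2 with hz
      have r1 : (z:ℝ) / (m:ℝ)^2 < (p':ℝ) / (m:ℝ)^2 := by linarith
      have r2 : (p':ℝ) / (m:ℝ)^2 < (z:ℝ) / (m:ℝ)^2 + 3 * dl N := by linarith
      rw [div_lt_div_iff_of_pos_right hm2] at r1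
      have r1' : z + 1 ≤ p' := by exact_mod_cast r1
      have r1'' : (z:ℝ) + 1 ≤ p' := by exact_mod_cast r1'
      rw [div_add' _ _ _ hm2.ne', div_lt_div_iff_of_pos_right hm2] at r2
      nlinarith
    rw [this, zero_mul]
  rw [e3, add_zero]
  apply Finset.sum_le_sum
  intro m hm
  rw [Finset.mem_filter, Finset.mem_Ioc] at hm
  obtain ⟨⟨m1, m2⟩, m3⟩ := hm
  have hdm0 := dl_pos (show 2 ≤ m by omega)
  have hdm := dl_anti h.N2 (show N ≤ m by omega)
  apply mul_le_mul_of_nonneg_right _ hdm0.le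
  have e4 : (Tset N x l n m (rho c N m)).card = ∑ p ∈ cand N x l n, ((Tset N x l n m (rho c N m)).filter (fun s => s.1 = p)).card := by
    apply Finset.card_eq_sum_card_fiberwise
    intro s hs
    have hs' : s ∈ Tset N x l n m (rho c N m) := hs
    rw [mem_Tset hd.le hn (by omega)] at hs'
    exact hs'.1
  rw [e4]
  push_cast
  apply Finset.sum_le_sum
  intro p hp
  have : (rset m ((p:ℝ) / (n:ℝ)^2 + dl N) (dl N)).card ≤ ((Tset N x l n m (rho c N m)).filter (fun s => s.1 = p)).card := by
    apply Finset.card_le_card_of_injOn (fun p' => (p, p'))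
    · intro p' hp'
      have hp'2 : p' ∈ rset m ((p:ℝ) / (n:ℝ)^2 + dl N) (dl N) := hp'
      rw [mem_rset (by omega)] at hp'2
      show (p, p') ∈ (Tset N x l n m (rho c N m)).filter (fun s => s.1 = p)
      rw [Finset.mem_filter, mem_Tset hd.le hn (by omega)]
      refine ⟨⟨hp, ?_⟩, rfl⟩
      have : 0 < c * dl m := by positivity
      unfold rho
      rw [abs_le]
      constructor <;> linarith [hp'2.1, hp'2.2]
    · intro a _ b _ hab
      exact (Prod.mk.inj hab).2
  exact_mod_cast this

lemma cand_card (h : SH l c q B N) (x : ℝ) {b : ℕ} (hb : b ∈ PB B) :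
    (N:ℝ)^2 * l / 2 ≤ (cand N x l (q * b)).card := by
  have hd := h.dpos
  have hl := h.hl
  have hNp := h.Npos
  obtain ⟨n1, n2, _, _, _⟩ := h.nb hb
  set n := q * b with hn_def
  have hnN : (N:ℝ) ≤ n := by exact_mod_cast n1.le
  have hnN4 : (n:ℝ) ≤ 4 * N := by exact_mod_cast n2
  unfold cand
  rw [Int.card_Icc]
  have h1 : ((⌊(n:ℝ)^2 * (x + l - 2 * dl N)⌋ + 1 - ⌈(n:ℝ)^2 * x⌉ : ℤ) : ℝ) ≤ ((⌊(n:ℝ)^2 * (x + l - 2 * dl N)⌋ + 1 - ⌈(n:ℝ)^2 * x⌉).toNat : ℝ) := by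
    exact_mod_cast Int.self_le_toNat _
  refine le_trans ?_ h1
  push_cast
  have h2 := Int.sub_one_lt_floor ((n:ℝ)^2 * (x + l - 2 * dl N))
  have h3 := Int.ceil_lt_add_one ((n:ℝ)^2 * x)
  have h4 := h.d2
  have h5 : dl N * (n:ℝ)^2 ≤ dl N * (4 * N)^2 := by gcongr
  have h6 : (N:ℝ)^2 * l ≤ (n:ℝ)^2 * l := by gcongr
  have h7 := h.lN
  have h8 := h.Nbig
  have h9 : 1000 ≤ (N:ℝ)^2 * l := by nlinarith
  nlinarith
end SH



/-- survivors -/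
structure Sv (c : ℝ) (q N : ℕ) (l : ℝ) (S : ℕ) (A : ℝ) (b : ℕ) (p : ℤ) : Prop where
  s1 : ¬ ∃ m ∈ Finset.Ioc S (Qf l), ∃ p' : ℤ, 
      |(p:ℝ) / ((q * b : ℕ):ℝ)^2 - (p':ℝ) / (m:ℝ)^2| ≤ rho c N m
  s2 : ¬ ∃ m ∈ (Finset.Ioc (Qf l) (4 * N)).filter (fun m => ¬ q * b ∣ m), ∃ p' : ℤ, 
      |(p:ℝ) / ((q * b : ℕ):ℝ)^2 - (p':ℝ) / (m:ℝ)^2| ≤ rho c N m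
  s3 : ¬ (A * dl N < Fut ((p:ℝ) / ((q * b : ℕ):ℝ)^2 + dl N) (dl N) (4 * N) (Qf (dl N)))

open scoped Classical in
noncomputable def surv (c : ℝ) (q N : ℕ) (x l : ℝ) (S : ℕ) (A : ℝ) (b : ℕ) : Finset ℤ :=
  (cand N x l (q * b)).filter (fun p => Sv c q N l S A b p)

namespace SH
variable {l c : ℝ} {q B N : ℕ}

lemma surv_card (h : SH l c q B N) (hc12 : c ≤ 1 / 10^12) {x : ℝ} {S : ℕ} (hS : 2 ≤ S) (hF : Fut x l S (Qf l) ≤ 10^7 * l) :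
    (PB B).card * ((N:ℝ)^2 * l / 4) ≤ ∑ b ∈ PB B, ((surv c q N x l S (10^7) b).card : ℝ) := by
  classical
  have hl := h.hl
  have hc := h.hc
  have hd := h.dpos
  have hNp := h.Npos
  have hb1 : ∀ b ∈ PB B, (N:ℝ)^2 * l / 2 - 65 * c * (N:ℝ)^2 * (10^7 * l) ≤ ((surv c q N x l S (10^7) b).card : ℝ) + 
      ∑ m ∈ (Finset.Ioc (Qf l) (4 * N)).filter (fun m => ¬ q * b ∣ m), ((Tset N x l (q * b) m (rho c N m)).card : ℝ) + 
      (∑ m ∈ (Finset.Ioc (4 * N) (Qf (dl N))).filter (fun m => ¬ q * b ∣ m), ((Tset N x l (q * b) m (rho c N m)).card : ℝ) * dl m) / (10^7 * dl N) := by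
    intro b hb
    have e1 := h.k1 hS hF hb
    have e2 := h.k2 x hb
    have e3 := h.k3 x (A := 10^7) hb
    have e4 := h.cand_card x hb
    rw [mul_comm, ← le_div_iff₀ (by positivity)] at e3
    have e5 : (cand N x l (q * b)) ⊆ surv c q N x l S (10^7) b ∪ 
        ((cand N x l (q * b)).filter (fun p : ℤ => ∃ m ∈ Finset.Ioc S (Qf l), ∃ p' : ℤ, 
      |(p:ℝ) / ((q * b : ℕ):ℝ)^2 - (p':ℝ) / (m:ℝ)^2| ≤ rho c N m) ∪
        ((cand N x l (q * b)).filter (fun p : ℤ => ∃ m ∈ (Finset.Ioc (Qf l) (4 * N)).filter (fun m => ¬ q * b ∣ m), ∃ p' : ℤ, 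
      |(p:ℝ) / ((q * b : ℕ):ℝ)^2 - (p':ℝ) / (m:ℝ)^2| ≤ rho c N m) ∪ 
        (cand N x l (q * b)).filter (fun p : ℤ => 
      10^7 * dl N < Fut ((p:ℝ) / ((q * b : ℕ):ℝ)^2 + dl N) (dl N) (4 * N) (Qf (dl N))))) := by
      intro p hp
      by_cases c1 : ∃ m ∈ Finset.Ioc S (Qf l), ∃ p' : ℤ, 
          |(p:ℝ) / ((q * b : ℕ):ℝ)^2 - (p':ℝ) / (m:ℝ)^2| ≤ rho c N m
      · apply Finset.mem_union_right; apply Finset.mem_union_left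
        rw [Finset.mem_filter]; exact ⟨hp, c1⟩
      by_cases c2 : ∃ m ∈ (Finset.Ioc (Qf l) (4 * N)).filter (fun m => ¬ q * b ∣ m), ∃ p' : ℤ, 
          |(p:ℝ) / ((q * b : ℕ):ℝ)^2 - (p':ℝ) / (m:ℝ)^2| ≤ rho c N m
      · apply Finset.mem_union_right; apply Finset.mem_union_right; apply Finset.mem_union_left
        rw [Finset.mem_filter]; exact ⟨hp, c2⟩
      by_cases c3 : 10^7 * dl N < Fut ((p:ℝ) / ((q * b : ℕ):ℝ)^2 + dl N) (dl N) (4 * N) (Qf (dl N))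
      · apply Finset.mem_union_right; apply Finset.mem_union_right; apply Finset.mem_union_right
        rw [Finset.mem_filter]; exact ⟨hp, c3⟩
      · apply Finset.mem_union_left
        unfold surv
        rw [Finset.mem_filter]; exact ⟨hp, ⟨c1, c2, c3⟩⟩
    have e6 := Finset.card_le_card e5
    have e7 := e6.trans (Finset.card_union_le _ _)
    have e8 := e7.trans (Nat.add_le_add_left (Finset.card_union_le _ _) _)
    have e9 := e8.trans (Nat.add_le_add_left (Nat.add_le_add_left (Finset.card_union_le _ _) _) _)
    have e10 : ((cand N x l (q * b)).card : ℝ) ≤ _ := Nat.cast_le.mpr e9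
    push_cast at e10
    push_cast at e1 e2 e3
    linarith
  have s1 := Finset.sum_le_sum hb1
  rw [Finset.sum_const, nsmul_eq_mul, Finset.sum_add_distrib, Finset.sum_add_distrib, ← Finset.sum_div] at s1
  have a1 := h.sumA x
  have a2 := h.sumB x
  have a3 : (∑ b ∈ PB B, ∑ m ∈ (Finset.Ioc (4 * N) (Qf (dl N))).filter (fun m => ¬ q * b ∣ m), 
      ((Tset N x l (q * b) m (rho c N m)).card : ℝ) * dl m) / (10^7 * dl N) ≤ 26 / 10^5 * ((PB B).card * (16 * l * (N:ℝ)^2)) := by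
    rw [div_le_iff₀ (by positivity)]
    refine a2.trans (le_of_eq (by ring))
  have hK : (0:ℝ) ≤ (PB B).card * ((N:ℝ)^2 * l) := by positivity
  have hK2 : c * ((PB B).card * ((N:ℝ)^2 * l)) ≤ 1 / 10^12 * ((PB B).card * ((N:ℝ)^2 * l)) := by gcongr
  nlinarith

lemma sv_far (h : SH l c q B N) {x : ℝ} {S : ℕ} {A : ℝ} {b : ℕ} {p : ℤ} (hs : Sv c q N l S A b p)
    {m : ℕ} (hm1 : S < m) (hm2 : m ≤ 4 * N) (hnm : ¬ q * b ∣ m) (p' : ℤ) : 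
    rho c N m < |(p:ℝ) / ((q * b : ℕ):ℝ)^2 - (p':ℝ) / (m:ℝ)^2| := by
  by_contra hcon
  push Not at hcon
  rcases le_or_gt m (Qf l) with hQ | hQ
  · exact hs.s1 ⟨m, Finset.mem_Ioc.mpr ⟨hm1, hQ⟩, p', hcon⟩
  · exact hs.s2 ⟨m, Finset.mem_filter.mpr ⟨Finset.mem_Ioc.mpr ⟨hQ, hm2⟩, hnm⟩, p', hcon⟩

lemma clean (h : SH l c q B N) {S : ℕ} (hS : 2 ≤ S) {A : ℝ} {b : ℕ} (hb : b ∈ PB B) {p : ℤ} (hs : Sv c q N l S A b p)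
    {z : ℝ} (hz1 : (p:ℝ) / ((q * b : ℕ):ℝ)^2 + dl N ≤ z) (hz2 : z ≤ (p:ℝ) / ((q * b : ℕ):ℝ)^2 + 2 * dl N)
    {m : ℕ} (hm1 : S < m) (hm2 : m ≤ 4 * N) : c / ((m:ℝ) * Real.log m) ≤ nint (z * (m:ℝ)^2) := by
  have hc := h.hc
  have hd := h.dpos
  have hNp := h.Npos
  obtain ⟨n1, n2, _, _, _⟩ := h.nb hb
  have hn : 0 < q * b := by omega
  have hm0 : (0:ℝ) < m := by exact_mod_cast (show 0 < m by omega)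
  have hm20 : (0:ℝ) < (m:ℝ)^2 := by positivity
  have hdm := dl_pos (show 2 ≤ m by omega)
  have key : c * dl m ≤ |z - (round (z * (m:ℝ)^2) : ℝ) / (m:ℝ)^2| := by
    set p' := round (z * (m:ℝ)^2)
    by_cases hnm : q * b ∣ m
    · obtain ⟨j, hj⟩ := hnm
      have hnr : (0:ℝ) < ((q * b : ℕ):ℝ) := by exact_mod_cast hn
      have hj0 : (0:ℝ) < j := by
        rcases Nat.eq_zero_or_pos j with h0 | h0
        · subst h0; omega
        · exact_mod_cast h0
      have hj1 : 1 ≤ j := by exact_mod_cast hj0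
      have hNm : N ≤ m := by rw [hj]; nlinarith
      have hda := dl_anti h.N2 hNm
      have hy : (p:ℝ) / ((q * b : ℕ):ℝ)^2 = ((p * (j:ℤ)^2 : ℤ):ℝ) / (m:ℝ)^2 := by
        have : (m:ℝ) = ((q * b : ℕ):ℝ) * j := by exact_mod_cast hj
        rw [this]; push_cast; field_simp
      rw [hy] at hz1 hz2
      set k : ℤ := p * (j:ℤ)^2
      have hc1 := h.hc1
      have hcd : c * dl m ≤ dl N := by nlinarith
      by_cases hk : p' = k
      · rw [hk]
        refine le_trans ?_ (le_abs_self _)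
        linarith
      · have hkk : 1 ≤ |(k:ℝ) - p'| := by
          have : 1 ≤ |k - p'| := Int.one_le_abs (sub_ne_zero.mpr (Ne.symm hk))
          exact_mod_cast this
        have hkk2 : 1 / (m:ℝ)^2 ≤ |(k:ℝ) / (m:ℝ)^2 - (p':ℝ) / (m:ℝ)^2| := by
          rw [← sub_div, abs_div, abs_of_pos hm20]
          gcongr
        have t1 := abs_sub_le ((k:ℝ) / (m:ℝ)^2) z ((p':ℝ) / (m:ℝ)^2)
        have t2 : |(k:ℝ) / (m:ℝ)^2 - z| ≤ 2 * dl N := by rw [abs_le]; constructor <;> linarith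
        have t3 : c * dl m + 2 * dl N ≤ 1 / (m:ℝ)^2 := by
          rw [le_div_iff₀ hm20]
          have u1 : dl m * (m:ℝ)^2 ≤ 1 := by rw [mul_comm]; exact m2dl_le (by omega)
          have u2 : dl N * (m:ℝ)^2 ≤ dl N * (4 * N)^2 := by
            gcongr; exact_mod_cast hm2
          have u3 := h.d2
          have u4 : c * (dl m * (m:ℝ)^2) ≤ 1 / 10^6 * 1 := by gcongr
          nlinarith
        linarith
    · have f := h.sv_far (x := 0) hs hm1 hm2 hnm p'
      have t1 := abs_sub_le ((p:ℝ) / ((q * b : ℕ):ℝ)^2) z ((p':ℝ) / (m:ℝ)^2)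
      have t2 : |(p:ℝ) / ((q * b : ℕ):ℝ)^2 - z| ≤ 2 * dl N := by rw [abs_le]; constructor <;> linarith
      unfold rho at f
      linarith
  have e : nint (z * (m:ℝ)^2) = |z - (round (z * (m:ℝ)^2) : ℝ) / (m:ℝ)^2| * (m:ℝ)^2 := by
    unfold nint
    generalize (round (z * (m:ℝ)^2)) = w
    calc _ = |(z - (w:ℝ) / (m:ℝ)^2) * (m:ℝ)^2| := by rw [sub_mul, div_mul_cancel₀ _ hm20.ne']
      _ = _ := by rw [abs_mul, abs_of_pos hm20]
  rw [e]
  calc c / ((m:ℝ) * Real.log m) = c * ((m:ℝ)^2 * dl m) := by rw [m2dl (by omega)]; ring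
    _ = c * dl m * (m:ℝ)^2 := by ring
    _ ≤ _ := by gcongr

lemma upper (h : SH l c q B N) {b : ℕ} (hb : b ∈ PB B) {p : ℤ} 
    {z : ℝ} (hz1 : (p:ℝ) / ((q * b : ℕ):ℝ)^2 + dl N ≤ z) (hz2 : z ≤ (p:ℝ) / ((q * b : ℕ):ℝ)^2 + 2 * dl N) :
    ((q * b : ℕ):ℝ) * Real.log ((q * b : ℕ):ℝ) * nint (z * ((q * b : ℕ):ℝ)^2) ≤ 256 := by
  have hd := h.dpos
  have hNp := h.Npos
  obtain ⟨n1, n2, _, _, _⟩ := h.nb hb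
  have hn : 0 < q * b := by omega
  set n := q * b
  have hnr : (0:ℝ) < n := by exact_mod_cast hn
  have hn4 : (n:ℝ) ≤ 4 * N := by exact_mod_cast n2
  have hn2 : (0:ℝ) < (n:ℝ)^2 := by positivity
  have h1 : nint (z * (n:ℝ)^2) ≤ 2 * dl N * (n:ℝ)^2 := by
    unfold nint
    refine (round_le _ p).trans ?_
    have e : z * (n:ℝ)^2 - p = (z - (p:ℝ) / (n:ℝ)^2) * (n:ℝ)^2 := by field_simp
    rw [e, abs_mul, abs_of_pos hn2]
    gcongr
    rw [abs_le]; constructor <;> linarith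
  have hlog0 : 0 < Real.log n := log_nat_pos (by have := h.N2; omega)
  have hlog : Real.log n ≤ 2 * Real.log N := by
    have : (2:ℝ) * Real.log N = Real.log ((N:ℝ)^2) := by rw [Real.log_pow]; norm_num
    rw [this]
    apply Real.log_le_log hnr
    have := h.Nbig
    nlinarith
  have hlN : 0 < Real.log N := log_nat_pos h.N2
  calc _ ≤ (4 * N : ℝ) * (2 * Real.log N) * (2 * dl N * (4 * N)^2) := by
        have : 2 * dl N * (n:ℝ)^2 ≤ 2 * dl N * (4 * N)^2 := by gcongr
        have h0 : 0 ≤ nint (z * (n:ℝ)^2) := abs_nonneg _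
        have := h1.trans this
        gcongr
    _ = 256 * (dl N * ((N:ℝ)^3 * Real.log N)) := by ring
    _ = 256 := by rw [h.dmul]; norm_num
    _ ≤ _ := le_refl _

lemma sep (h : SH l c q B N) {S : ℕ} (hSQ : S ≤ N) {A : ℝ} {b b' : ℕ} (hb : b ∈ PB B) (hb' : b' ∈ PB B) {p p' : ℤ} (hs : Sv c q N l S A b p)
    (hne : b ≠ b' ∨ p ≠ p') : 
    3 * dl N < |(p:ℝ) / ((q * b : ℕ):ℝ)^2 - (p':ℝ) / ((q * b' : ℕ):ℝ)^2| := by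
  have hc := h.hc
  have hd := h.dpos
  have hNp := h.Npos
  by_cases hbb : b = b'
  · subst hbb
    have hp : p ≠ p' := by tauto
    obtain ⟨n1, n2, _, _, _⟩ := h.nb hb
    have hn : 0 < q * b := by omega
    set n := q * b
    have hn2 : (0:ℝ) < (n:ℝ)^2 := by positivity
    have hkk : 1 ≤ |(p:ℝ) - p'| := by
      have : 1 ≤ |p - p'| := Int.one_le_abs (sub_ne_zero.mpr hp)
      exact_mod_cast this
    rw [← sub_div, abs_div, abs_of_pos hn2, lt_div_iff₀ hn2]
    have : dl N * (n:ℝ)^2 ≤ dl N * (4 * N)^2 := by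
      gcongr; exact_mod_cast n2
    have := h.d2
    nlinarith
  · obtain ⟨n1', n2', p2', _, _⟩ := h.nb hb'
    obtain ⟨n1, n2, p2, _, _⟩ := h.nb hb
    have hnm : ¬ q * b ∣ q * b' := by
      intro hdiv
      have := Nat.dvd_of_mul_dvd_mul_left h.hq.pos hdiv
      exact hbb ((Nat.prime_dvd_prime_iff_eq p2 p2').mp this)
    have f := h.sv_far (x := 0) hs (show S < q * b' by omega) n2' hnm p'
    have := dl_pos (show 2 ≤ q * b' by have := h.N2; omega)
    have : 0 < c * dl (q * b') := by positivity
    unfold rho at f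
    linarith

theorem step0 (h : SH l c q B N) (hc12 : c ≤ 1 / 10^12) {x : ℝ} {S : ℕ} (hS : 2 ≤ S) (hSN : S ≤ N)
    (hF : Fut x l S (Qf l) ≤ 10^7 * l) : ∃ Y : Finset ℝ, 
    (PB B).card * ((N:ℝ)^2 * l / 4) ≤ (Y.card : ℝ) ∧ 
    (∀ y ∈ Y, x ≤ y ∧ y + dl N ≤ x + l ∧ 
      (∀ z, y ≤ z → z ≤ y + dl N → ∀ m : ℕ, S < m → m ≤ 4 * N → c / ((m:ℝ) * Real.log m) ≤ nint (z * (m:ℝ)^2)) ∧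
      (∃ n : ℕ, N < n ∧ ∀ z, y ≤ z → z ≤ y + dl N → (n:ℝ) * Real.log n * nint (z * (n:ℝ)^2) ≤ 256) ∧
      Fut y (dl N) (4 * N) (Qf (dl N)) ≤ 10^7 * dl N) ∧
    (∀ y ∈ Y, ∀ y' ∈ Y, y ≠ y' → 3 * dl N < |y - y'|) ∧
    (∀ s D : ℝ, 0 ≤ D → ((Y.filter (fun y => s ≤ y ∧ y ≤ s + D)).card : ℝ) ≤ (PB B).card * (1 + 16 * (N:ℝ)^2 * D)) := by
  classical
  have hd := h.dpos
  have hNp := h.Npos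
  set Z : Finset (Σ _ : ℕ, ℤ) := (PB B).sigma (fun b => surv c q N x l S (10^7) b) with hZ
  set f : (Σ _ : ℕ, ℤ) → ℝ := fun s => (s.2:ℝ) / ((q * s.1 : ℕ):ℝ)^2 + dl N with hf
  have hmem : ∀ s ∈ Z, s.1 ∈ PB B ∧ s.2 ∈ cand N x l (q * s.1) ∧ Sv c q N l S (10^7) s.1 s.2 := by
    intro s hs
    rw [hZ, Finset.mem_sigma] at hs
    unfold surv at hs
    rw [Finset.mem_filter] at hs
    exact ⟨hs.1, hs.2.1, hs.2.2⟩
  have hsep : ∀ s ∈ Z, ∀ t ∈ Z, s ≠ t → 3 * dl N < |f s - f t| := by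
    rintro ⟨b, p⟩ hs ⟨b', p'⟩ ht hst
    obtain ⟨u1, u2, u3⟩ := hmem _ hs
    obtain ⟨v1, v2, v3⟩ := hmem _ ht
    have := h.sep hSN u1 v1 (p' := p') u3 (by
      by_contra hcon
      push Not at hcon
      obtain ⟨rfl, rfl⟩ := hcon
      exact hst rfl)
    simp only [hf, add_sub_add_right_eq_sub]
    exact this
  have hinj : Set.InjOn f Z := by
    intro s hs t ht hst
    by_contra hne
    have := hsep s hs t ht hne
    rw [hst, sub_self, abs_zero] at this
    linarith
  refine ⟨Z.image f, ?_, ?_, ?_, ?_⟩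
  · rw [Finset.card_image_of_injOn hinj, hZ, Finset.card_sigma]
    push_cast
    exact h.surv_card hc12 hS hF
  · intro y hy
    rw [Finset.mem_image] at hy
    obtain ⟨⟨b, p⟩, hs, rfl⟩ := hy
    obtain ⟨u1, u2, u3⟩ := hmem _ hs
    dsimp only at u1 u2 u3
    obtain ⟨n1, n2, _, _, _⟩ := h.nb u1
    rw [mem_cand (by omega)] at u2
    simp only [hf]
    refine ⟨by linarith [u2.1], by linarith [u2.2], ?_, ⟨q * b, n1, ?_⟩, not_lt.mp u3.s3⟩
    · intro z z1 z2 m m1 m2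
      exact h.clean hS u1 u3 z1 (by linarith) m1 m2
    · intro z z1 z2
      exact h.upper u1 z1 (by linarith)
  · intro y hy y' hy' hne
    rw [Finset.mem_image] at hy hy'
    obtain ⟨s, hs, rfl⟩ := hy
    obtain ⟨t, ht, rfl⟩ := hy'
    exact hsep s hs t ht (fun e => hne (by rw [e]))
  · intro s D hD
    have hsub : (Z.image f).filter (fun y => s ≤ y ∧ y ≤ s + D) ⊆ (PB B).biUnion (fun b => 
        ((cand N x l (q * b)).filter (fun p : ℤ => |(p:ℝ) / ((q * b : ℕ):ℝ)^2 - (s - dl N + D / 2)| ≤ D / 2)).image (fun p => f ⟨b, p⟩)) := by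
      intro y hy
      rw [Finset.mem_filter, Finset.mem_image] at hy
      obtain ⟨⟨⟨b, p⟩, hs, rfl⟩, y1, y2⟩ := hy
      obtain ⟨u1, u2, u3⟩ := hmem _ hs
      rw [Finset.mem_biUnion]
      refine ⟨b, u1, ?_⟩
      rw [Finset.mem_image]
      refine ⟨p, ?_, rfl⟩
      rw [Finset.mem_filter]
      refine ⟨u2, ?_⟩
      simp only [hf] at y1 y2
      rw [abs_le]; constructor <;> linarith
    have c1 := (Finset.card_le_card hsub).trans Finset.card_biUnion_le
    have c2 := c1.trans (Finset.sum_le_sum (fun b _ => Finset.card_image_le))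
    have c3 : (((Z.image f).filter (fun y => s ≤ y ∧ y ≤ s + D)).card : ℝ) ≤ _ := Nat.cast_le.mpr c2
    refine c3.trans ?_
    push_cast
    rw [← nsmul_eq_mul, ← Finset.sum_const]
    apply Finset.sum_le_sum
    intro b hb
    obtain ⟨n1, n2, _, _, _⟩ := h.nb hb
    have := int_near_card (cand N x l (q * b)) (q * b) (by omega) (s - dl N + D / 2) (D / 2) (by positivity)
    push_cast at this
    refine this.trans ?_
    have h4 : ((q:ℝ) * b) ≤ 4 * N := by exact_mod_cast n2
    have : ((q:ℝ) * b)^2 ≤ (4 * N)^2 := by gcongr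
    nlinarith
end SH


lemma sort_fin (Y : Finset ℝ) (M : ℕ) (hM : M ≤ Y.card) : ∃ y : ℕ → ℝ, (∀ i < M, y i ∈ Y) ∧ 
    ∀ i j, i < j → j < M → y i < y j ∧ ((j:ℝ) - i + 1) ≤ ((Y.filter (fun t => y i ≤ t ∧ t ≤ y j)).card : ℝ) := by
  classical
  set e := Y.orderEmbOfFin rfl with he
  set y : ℕ → ℝ := fun i => if h : i < Y.card then e ⟨i, h⟩ else 0 with hy
  have hye : ∀ i (h : i < Y.card), y i = e ⟨i, h⟩ := by
    intro i h; simp only [hy, h, dif_pos]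
  have hmono : ∀ i j, i < j → j < M → y i < y j := by
    intro i j hij hj
    rw [hye i (by omega), hye j (by omega)]
    exact e.strictMono (by simpa using hij)
  have hmem : ∀ i < M, y i ∈ Y := by
    intro i hi
    rw [hye i (by omega)]
    exact Finset.orderEmbOfFin_mem _ _ _
  refine ⟨y, hmem, ?_⟩
  intro i j hij hj
  refine ⟨hmono i j hij hj, ?_⟩
  have hle : ∀ a b, a ≤ b → b < M → y a ≤ y b := by
    intro a b hab hb
    rcases hab.eq_or_lt with rfl | h
    · exact le_refl _
    · exact (hmono a b h hb).le
  have hc : (Finset.Icc i j).card ≤ (Y.filter (fun t => y i ≤ t ∧ t ≤ y j)).card := by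
    apply Finset.card_le_card_of_injOn y
    · intro t ht
      have ht' : t ∈ Finset.Icc i j := ht
      rw [Finset.mem_Icc] at ht'
      show y t ∈ Y.filter (fun t => y i ≤ t ∧ t ≤ y j)
      rw [Finset.mem_filter]
      exact ⟨hmem t (by omega), hle _ _ ht'.1 (by omega), hle _ _ ht'.2 hj⟩
    · intro t ht u hu htu
      have ht' : t ∈ Finset.Icc i j := ht
      have hu' : u ∈ Finset.Icc i j := hu
      rw [Finset.mem_Icc] at ht' hu'
      rcases lt_trichotomy t u with h | h | h
      · have := hmono t u h (by omega); linarith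
      · exact h
      · have := hmono u t h (by omega); linarith
  rw [Nat.card_Icc] at hc
  have : ((j + 1 - i : ℕ):ℝ) = (j:ℝ) - i + 1 := by
    rw [Nat.cast_sub (by omega)]; push_cast; ring
  rw [← this]
  exact_mod_cast hc

noncomputable def Mf (l : ℝ) (B N : ℕ) : ℕ := ⌊(PB B).card * ((N:ℝ)^2 * l / 4)⌋₊

lemma holder2 {cnt K M T X D a s : ℝ} (hcnt0 : 0 < cnt) (hK : 0 < K) (hM : 0 < M) (hT : 0 ≤ T) (hD0 : 0 < D) (hd : 0 < a) 
    (hs : 0 < s) (hs1 : s ≤ 1) (hH : 8 ≤ X * (K * a)^s) (k4 : K * X ≤ 8 * M) (hT144 : 144 ≤ T)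
    (e1 : cnt ≤ 18 * K) (c1 : cnt ≤ D / a) : cnt ≤ T * M * D^s := by
  have e2 : cnt ≤ (18 * K)^(1 - s) * (D / a)^s := by
    calc cnt = cnt^(1 - s) * cnt^s := by
          rw [← Real.rpow_add hcnt0]; norm_num
      _ ≤ _ := by
          have : 0 ≤ 1 - s := by linarith
          gcongr
  refine e2.trans ?_
  have e3 : (18 * K)^(1 - s) ≤ 18 * K^(1 - s) := by
    rw [Real.mul_rpow (by norm_num) hK.le]
    gcongr
    calc (18:ℝ)^(1 - s) ≤ (18:ℝ)^(1:ℝ) := Real.rpow_le_rpow_of_exponent_le (by norm_num) (by linarith)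
      _ = 18 := Real.rpow_one _
  rw [Real.div_rpow hD0.le hd.le]
  have hds : 0 < a^s := Real.rpow_pos_of_pos hd s
  have hKs : 0 < K^s := Real.rpow_pos_of_pos hK s
  have hDs : 0 < D^s := Real.rpow_pos_of_pos hD0 s
  rw [Real.mul_rpow hK.le hd.le] at hH
  have e4 : K^(1 - s) = K / K^s := by
    rw [Real.rpow_sub hK, Real.rpow_one]
  rw [e4] at e3
  generalize hu : K^s = u at *
  generalize hv : a^s = v at *
  generalize hw : D^s = w at *
  have e5 : 18 * K ≤ T * M * (u * v) := by
    calc 18 * K = 18 * K * 1 := by ring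
      _ ≤ 18 * K * (X * (u * v)) := by gcongr; linarith
      _ = 18 * (K * X) * (u * v) := by ring
      _ ≤ 18 * (8 * M) * (u * v) := by gcongr
      _ = 144 * M * (u * v) := by ring
      _ ≤ _ := by gcongr
  calc _ ≤ 18 * (K / u) * (w / v) := by gcongr
    _ = (18 * K) * (w / (u * v)) := by field_simp
    _ ≤ T * M * (u * v) * (w / (u * v)) := by gcongr
    _ = _ := by field_simp

namespace SH
variable {l c : ℝ} {q B N : ℕ}

lemma Kfacts (h : SH l c q B N) {s : ℝ} (hs : 0 < s) (hH : 8 ≤ (N:ℝ)^2 * l * ((PB B).card * dl N)^s) :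
    1 ≤ ((PB B).card : ℝ) ∧ 8 ≤ (N:ℝ)^2 * l ∧ 2 ≤ Mf l B N ∧ (PB B).card * ((N:ℝ)^2 * l) ≤ 8 * Mf l B N := by
  have hd := h.dpos
  have hl := h.hl
  have hNp := h.Npos
  have k1 : 1 ≤ ((PB B).card : ℝ) := by
    have : (PB B).card ≠ 0 := by
      intro h0
      rw [h0, Nat.cast_zero, zero_mul, Real.zero_rpow hs.ne', mul_zero] at hH
      linarith
    exact_mod_cast Nat.one_le_iff_ne_zero.mpr this
  have k4 : ((PB B).card : ℝ) ≤ 4 * N := by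
    have h1 : (PB B).card ≤ 4 * N := by
      unfold PB
      refine (Finset.card_filter_le _ _).trans ?_
      rw [Nat.card_Ioc]
      have : B ≤ N := by rw [h.hN]; exact Nat.le_mul_of_pos_left _ h.hq.pos
      omega
    exact_mod_cast h1
  have ka : (PB B).card * dl N ≤ 1 := by
    have h1 := h.d2
    have h2 := h.Nbig
    calc (PB B).card * dl N ≤ 4 * N * dl N := by gcongr
      _ ≤ dl N * (N:ℝ)^2 := by nlinarith [mul_pos hd hNp]
      _ ≤ 1 := by linarith
  have k2 : 8 ≤ (N:ℝ)^2 * l := by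
    have : ((PB B).card * dl N)^s ≤ 1 := Real.rpow_le_one (by positivity) ka hs.le
    have h3 : (0:ℝ) < (N:ℝ)^2 * l := by positivity
    nlinarith
  have k3 : 2 ≤ ((PB B).card : ℝ) * ((N:ℝ)^2 * l / 4) := by nlinarith
  have k5 : 2 ≤ Mf l B N := by
    unfold Mf
    apply Nat.le_floor
    exact_mod_cast k3
  refine ⟨k1, k2, k5, ?_⟩
  have h6 := Nat.lt_floor_add_one (((PB B).card : ℝ) * ((N:ℝ)^2 * l / 4))
  have h7 : (2:ℝ) ≤ Mf l B N := by exact_mod_cast k5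
  unfold Mf at *
  nlinarith

/-- propagation of the mass invariant -/
lemma inv_next (h : SH l c q B N) (hl1 : l ≤ 1) {s : ℝ} (hs : 0 < s) (hs1 : s ≤ 1) (hH : 8 ≤ (N:ℝ)^2 * l * ((PB B).card * dl N)^s)
    {T : ℝ} (hT : 0 ≤ T) (hinv : 144 ≤ T * l^s) : 144 ≤ T * Mf l B N * (dl N)^s := by
  obtain ⟨k1, k2, k3, k4⟩ := h.Kfacts hs hH
  have hd := h.dpos
  have hl := h.hl
  have hNp := h.Npos
  have hK : 0 < ((PB B).card : ℝ) := by linarith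
  rw [Real.mul_rpow hK.le hd.le] at hH
  have h1 : ((PB B).card : ℝ)^s ≤ (PB B).card := by
    calc _ ≤ ((PB B).card : ℝ)^(1:ℝ) := Real.rpow_le_rpow_of_exponent_le k1 hs1
      _ = _ := Real.rpow_one _
  have hds : 0 < (dl N)^s := Real.rpow_pos_of_pos hd s
  have h2 : 1 ≤ Mf l B N * (dl N)^s := by
    have : 8 ≤ (N:ℝ)^2 * l * ((PB B).card * (dl N)^s) := hH.trans (by gcongr)
    nlinarith
  have h3 : l^s ≤ 1 := Real.rpow_le_one hl.le hl1 hs.le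
  nlinarith

theorem step1 (h : SH l c q B N) (hl1 : l ≤ 1) (hc12 : c ≤ 1 / 10^12) {x : ℝ} {S : ℕ} (hS : 2 ≤ S) (hSN : S ≤ N)
    (hF : Fut x l S (Qf l) ≤ 10^7 * l) 
    {s : ℝ} (hs : 0 < s) (hs1 : s ≤ 1) (hH : 8 ≤ (N:ℝ)^2 * l * ((PB B).card * dl N)^s)
    {T : ℝ} (hT : 0 ≤ T) (hinv : 144 ≤ T * l^s) : ∃ y : ℕ → ℝ, 
    (∀ i < Mf l B N, x ≤ y i ∧ y i + dl N ≤ x + l ∧ 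
      (∀ z, y i ≤ z → z ≤ y i + dl N → ∀ m : ℕ, S < m → m ≤ 4 * N → c / ((m:ℝ) * Real.log m) ≤ nint (z * (m:ℝ)^2)) ∧
      (∃ n : ℕ, N < n ∧ ∀ z, y i ≤ z → z ≤ y i + dl N → (n:ℝ) * Real.log n * nint (z * (n:ℝ)^2) ≤ 256) ∧
      Fut (y i) (dl N) (4 * N) (Qf (dl N)) ≤ 10^7 * dl N) ∧
    ∀ i j, i < j → j < Mf l B N → y i + dl N < y j ∧ ((j:ℝ) - i + 1) ≤ T * Mf l B N * (y j - y i - dl N)^s := by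
  obtain ⟨k1, k2, k3, k4⟩ := h.Kfacts hs hH
  have hd := h.dpos
  have hl := h.hl
  have hNp := h.Npos
  have hK : 0 < ((PB B).card : ℝ) := by linarith
  obtain ⟨Y, y1, y2, y3, y4⟩ := h.step0 hc12 hS hSN hF
  have hMY : Mf l B N ≤ Y.card := by
    unfold Mf
    exact Nat.floor_le_of_le y1
  obtain ⟨y, hy1, hy2⟩ := sort_fin Y _ hMY
  refine ⟨y, fun i hi => y2 _ (hy1 i hi), ?_⟩
  intro i j hij hj
  obtain ⟨o1, o2⟩ := hy2 i j hij hj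
  have hi : i < Mf l B N := by omega
  have o3 := y3 _ (hy1 j hj) _ (hy1 i hi) o1.ne'
  rw [abs_of_pos (by linarith)] at o3
  set D := y j - y i - dl N with hD
  have hDa : 2 * dl N ≤ D := by linarith
  have hD0 : 0 < D := by linarith
  have hDl : D ≤ l := by linarith [(y2 _ (hy1 i hi)).1, (y2 _ (hy1 j hj)).2.1]
  refine ⟨by linarith, ?_⟩
  set cnt : ℝ := (j:ℝ) - i + 1 with hcnt
  have hcnt0 : 0 < cnt := by
    have : (i:ℝ) < j := by exact_mod_cast hij
    linarith
  have c1 : cnt ≤ D / dl N := by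
    have := card_sep (Y.filter (fun t => y i ≤ t ∧ t ≤ y j)) (fun t => t / (3 * dl N)) ((D + dl N) / (3 * dl N)) (by positivity)
      (by
        intro u hu v hv huv
        rw [Finset.mem_filter] at hu hv
        have := y3 u hu.1 v hv.1 huv
        rw [← sub_div, abs_div, abs_of_pos (show 0 < 3 * dl N by positivity), one_le_div (by positivity)]
        exact this.le)
      (by
        intro u hu v hv
        rw [Finset.mem_filter] at hu hv
        rw [← sub_div]
        gcongr
        linarith [hu.2.2, hv.2.1])
    refine (o2.trans this).trans ?_
    rw [le_div_iff₀ hd, add_mul, one_mul, div_mul_eq_mul_div, ← le_sub_iff_add_le', div_le_iff₀ (by positivity)]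
    nlinarith
  have c2 : cnt ≤ (PB B).card * (2 + 16 * (N:ℝ)^2 * D) := by
    have := y4 (y i) (D + dl N) (by positivity)
    have e : y i + (D + dl N) = y j := by rw [hD]; ring
    rw [e] at this
    refine (o2.trans this).trans ?_
    have := h.d2
    apply mul_le_mul_of_nonneg_left _ hK.le
    nlinarith
  have hDs : 0 < D^s := Real.rpow_pos_of_pos hD0 s
  have hls : 0 < l^s := Real.rpow_pos_of_pos hl s
  have hMp : (0:ℝ) < Mf l B N := by exact_mod_cast (show 0 < Mf l B N by omega)
  rcases le_or_gt 1 ((N:ℝ)^2 * D) with hcase | hcase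
  · have e1 : cnt ≤ 18 * (PB B).card * ((N:ℝ)^2 * D) := by nlinarith
    have e2 : cnt ≤ 144 * Mf l B N * (D / l) := by
      have : 18 * (PB B).card * ((N:ℝ)^2 * D) = 18 * ((PB B).card * ((N:ℝ)^2 * l)) * (D / l) := by field_simp
      rw [this] at e1
      refine e1.trans ?_
      have : 18 * ((PB B).card * ((N:ℝ)^2 * l)) ≤ 144 * Mf l B N := by linarith
      gcongr
    have e3 : D / l ≤ (D / l)^s := by
      have : D / l ≤ 1 := by rw [div_le_one hl]; exact hDl
      calc D / l = (D / l)^(1:ℝ) := (Real.rpow_one _).symm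
        _ ≤ _ := Real.rpow_le_rpow_of_exponent_ge (by positivity) this hs1
    calc cnt ≤ 144 * Mf l B N * (D / l)^s := e2.trans (by gcongr)
      _ = 144 * (Mf l B N * (D^s / l^s)) := by rw [Real.div_rpow hD0.le hl.le]; ring
      _ ≤ T * l^s * (Mf l B N * (D^s / l^s)) := by gcongr
      _ = _ := by field_simp
  · have e1 : cnt ≤ 18 * (PB B).card := by nlinarith
    have hl3 : l^s ≤ 1 := Real.rpow_le_one hl.le hl1 hs.le
    exact holder2 hcnt0 hK hMp hT hD0 hd hs hs1 hH k4 (hinv.trans (mul_le_of_le_one_right hT hl3)) e1 c1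
end SH


lemma num_q (G : ℝ) (hG : 1 ≤ G) : ∃ q : ℕ, q.Prime ∧ G^5 < q ∧ (q:ℝ) ≤ 4 * G^5 := by
  have h5 : 1 ≤ G^5 := one_le_pow₀ hG
  obtain ⟨q, hq, h1, h2⟩ := Nat.exists_prime_lt_and_le_two_mul ⌈G^5⌉₊ (by
    have : 0 < ⌈G^5⌉₊ := Nat.ceil_pos.mpr (by linarith)
    omega)
  refine ⟨q, hq, lt_of_le_of_lt (Nat.le_ceil _) (by exact_mod_cast h1), ?_⟩
  have h3 : (q:ℝ) ≤ 2 * ⌈G^5⌉₊ := by exact_mod_cast h2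
  have h4 := Nat.ceil_lt_add_one (show 0 ≤ G^5 by linarith)
  linarith

lemma num_Q (G : ℝ) (g1 : 10^8 ≤ Real.log G) (hG : 10^8 ≤ G) : 2 ≤ Qf (1 / G) ∧ Real.log G / 4 ≤ Real.log (Qf (1 / G)) := by
  have hG0 : 0 < G := by linarith
  have hl : 0 < 1 / G := by positivity
  have h2 : 2 ≤ Qf (1 / G) := by
    rw [le_Qf hl]
    push_cast
    rw [mul_one_div, div_mul_eq_mul_div, div_le_one hG0]; linarith
  refine ⟨h2, ?_⟩
  have h3 : 1 < 256 * (1 / G) * ((Qf (1 / G) + 1 : ℕ):ℝ)^2 := (Qf_lt hl _).mp (by omega)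
  set Q := Qf (1 / G)
  have hQ : (2:ℝ) ≤ Q := by exact_mod_cast h2
  rw [mul_one_div, div_mul_eq_mul_div, one_lt_div hG0] at h3
  push_cast at h3
  have h4 : G ≤ 1024 * (Q:ℝ)^2 := by nlinarith
  have h5 : (1024:ℝ) ≤ Q := by
    by_contra hcon
    push Not at hcon
    -- G ≤ 1024^3 but G is at least exp of 10^8
    have : G ≤ 1024 * 1024^2 := h4.trans (by gcongr)
    have h6 : Real.log G ≤ Real.log (2^30) := Real.log_le_log hG0 (by linarith)
    rw [Real.log_pow] at h6
    have := Real.log_two_lt_d9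
    norm_num at h6
    linarith
  have h6 : G ≤ (Q:ℝ)^4 := by nlinarith [sq_nonneg (Q:ℝ)]
  have h7 : Real.log G ≤ Real.log ((Q:ℝ)^4) := Real.log_le_log hG0 h6
  rw [Real.log_pow] at h7
  push_cast at h7
  linarith

set_option maxHeartbeats 4000000 in
theorem num (r : ℕ) (hr : 2 ≤ r) (B0 : ℕ) (hB0 : ∀ B ≥ B0, (B:ℝ) / (2 * Real.log B) ≤ ((PB B).card : ℝ))
    (c : ℝ) (hc : c = 1 / 10^12 / (r + 1)) (G : ℝ) (g1 : 10^8 ≤ Real.log G) 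
    (g2 : 10000 * (r + 1) * Real.log G ≤ G) (g3 : 3 ≤ c * G) (g4 : (B0:ℝ) ≤ G) :
    ∃ q B N : ℕ, SH (1 / G) c q B N ∧ 8 ≤ (N:ℝ)^2 * (1 / G) * ((PB B).card * dl N)^((r:ℝ) / (r + 1)) := by
  have hr0 : (2:ℝ) ≤ r := by exact_mod_cast hr
  have hc0 : 0 < c := by rw [hc]; positivity
  have hG8 : 10^8 ≤ G := by nlinarith
  have hG0 : 0 < G := by linarith
  have hG1 : 1 ≤ G := by linarith
  obtain ⟨q, hq, q1, q2⟩ := num_q G hG1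
  obtain ⟨hQ2, hQlog⟩ := num_Q G g1 hG8
  have p54 : G^5 = G^4 * G := by ring
  have p4 : 1 ≤ G^4 := one_le_pow₀ hG1
  have p43 : G^4 = G^3 * G := by ring
  have p3 : 1 ≤ G^3 := one_le_pow₀ hG1
  have p2 : 1 ≤ G^2 := one_le_pow₀ hG1
  have hq0 : (0:ℝ) < q := by linarith [one_le_pow₀ hG1 (n := 5)]
  have hqG4 : 10^8 * G^4 ≤ q := by nlinarith
  have hqG3 : 10^8 * G^3 ≤ q := by nlinarith
  have hqG2 : 10^8 * G^2 ≤ q := by nlinarith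
  have hqG : 10^8 * G ≤ q := by nlinarith
  have hq1 : (1:ℝ) ≤ q := by linarith
  -- logs
  have hlq : Real.log q ≤ 6 * Real.log G := by
    have h1 : Real.log q ≤ Real.log (G^6) := by
      apply Real.log_le_log hq0
      have : G^6 = G^5 * G := by ring
      nlinarith [one_le_pow₀ hG1 (n := 5)]
    rw [Real.log_pow] at h1
    exact_mod_cast h1
  have hlq2 : 5 * Real.log G ≤ Real.log q := by
    have h1 : Real.log (G^5) ≤ Real.log q := Real.log_le_log (by positivity) q1.le
    rw [Real.log_pow] at h1
    exact_mod_cast h1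
  set B : ℕ := q^r with hB
  set N : ℕ := q^(r+1) with hN
  have hBr : (B:ℝ) = (q:ℝ)^r := by rw [hB]; push_cast; ring
  have hNr : (N:ℝ) = (q:ℝ)^(r+1) := by rw [hN]; push_cast; ring
  have hNB : (N:ℝ) = q * B := by rw [hNr, hBr]; ring
  have hqB : q ≤ B := by
    rw [hB]; exact Nat.le_self_pow (by omega) q
  have hqBr : (q:ℝ) ≤ B := by exact_mod_cast hqB
  have hB0' : (0:ℝ) < B := by linarith
  have hN0 : (0:ℝ) < N := by rw [hNB]; positivity
  have hGN4 : 4 * G ≤ N := by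
    rw [hNB]
    calc 4 * G ≤ q * 1 := by linarith
      _ ≤ q * B := by gcongr; linarith
  have hGN : G ≤ N := by linarith
  have hlogN : Real.log N = (r + 1) * Real.log q := by
    rw [hNr, Real.log_pow]; push_cast; ring
  have hlogB : Real.log B = r * Real.log q := by
    rw [hBr, Real.log_pow]
  have hlogq0 : 0 < Real.log q := by linarith
  have hL1 : Real.log N ≤ 6 * (r + 1) * Real.log G := by rw [hlogN]; nlinarith
  have hLG : Real.log N ≤ G / 1000 := by linarith
  have hlog4N : Real.log (4 * N) ≤ 7 * (r + 1) * Real.log G := by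
    rw [Real.log_mul (by norm_num) hN0.ne']
    have : Real.log 4 ≤ 3 := (Real.log_le_sub_one_of_pos (by norm_num)).trans (by norm_num)
    nlinarith
  -- B = q^(r-1)*q
  obtain ⟨k, rfl⟩ : ∃ k, r = k + 1 := ⟨r - 1, by omega⟩
  set E : ℝ := (q:ℝ)^k with hE
  have hE1 : (q:ℝ) ≤ E := by
    rw [hE]; exact le_self_pow₀ hq1 (by omega)
  have hE0 : 0 < E := by linarith
  have hBE : (B:ℝ) = q * E := by rw [hBr, pow_succ, hE]; ring
  -- prime count
  have hK : (B:ℝ) / G ≤ (PB B).card := by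
    have h1 : B ≥ B0 := by
      have : (B0:ℝ) ≤ B := by linarith
      exact_mod_cast this
    refine le_trans ?_ (hB0 B h1)
    have hlB0 : 0 < Real.log B := by rw [hlogB]; positivity
    have : Real.log B ≤ Real.log N := by rw [hlogB, hlogN]; linarith
    gcongr
    linarith
  have hKE : (q:ℝ) * E ≤ (PB B).card * G := by rwa [hBE, div_le_iff₀ hG0] at hK
  have hK0 : (0:ℝ) < (PB B).card := lt_of_lt_of_le (by positivity) hK
  have inv1 : (400:ℝ) / (1 / G)^2 = 400 * G^2 := by field_simp
  have hsum : 640 * c * (∑ m ∈ Finset.Ioc (Qf (1 / G)) (4 * N), 1 / ((m:ℝ) * Real.log m)) ≤ 1/1000 := by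
    have hQN : Qf (1 / G) ≤ 4 * N := by
      have h1 := (le_Qf (show 0 < 1 / G by positivity) (Qf (1 / G))).mp le_rfl
      rw [mul_one_div, div_mul_eq_mul_div, div_le_one hG0] at h1
      have h2 : (2:ℝ) ≤ Qf (1 / G) := by exact_mod_cast hQ2
      have h3 : (Qf (1 / G) : ℝ) ≤ G := by nlinarith only [h1, h2]
      have h4 := hGN
      have : (Qf (1 / G) : ℝ) ≤ ((4 * N : ℕ):ℝ) := by push_cast; linarith
      exact_mod_cast this
    have h1 := sum_inv_mlog _ _ hQ2 hQN
    have hlQ0 : 0 < Real.log (Qf (1 / G)) := by linarith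
    have h2 : Real.log ((4 * N : ℕ):ℝ) / Real.log (Qf (1 / G)) ≤ 28 * (((k + 1 : ℕ):ℝ) + 1) := by
      rw [div_le_iff₀ hlQ0]
      push_cast at hlog4N ⊢
      have := mul_le_mul_of_nonneg_left hQlog (show 0 ≤ 28 * ((k:ℝ)+1+1) by positivity)
      linarith
    have h4N0 : 0 < Real.log ((4 * N : ℕ):ℝ) := by
      apply Real.log_pos; push_cast; linarith
    have h3 := Real.log_le_sub_one_of_pos (div_pos h4N0 hlQ0)
    have h4 : ∑ m ∈ Finset.Ioc (Qf (1 / G)) (4 * N), 1 / ((m:ℝ) * Real.log m) ≤ 28 * (((k + 1 : ℕ):ℝ) + 1) := by linarith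
    calc _ ≤ 640 * c * (28 * (((k + 1 : ℕ):ℝ) + 1)) := by gcongr
      _ = 640 * 28 / 10^12 := by rw [hc]; field_simp
      _ ≤ _ := by norm_num
  have hexc : (1 + Real.log (Uf (1 / G) N)) * ((2 * (Hf (1 / G)) + 1) * (2 * (1 + 4 * (4 * N) / (q:ℝ)^2)) + 
      (PB B).card / (q:ℝ)^2 * (1 + 4 * (4 * N) / B)) ≤ (PB B).card / 1000 := by
    have u1 : ((Uf (1 / G) N : ℕ):ℝ) ≤ 4 / (1 / G) * N := Nat.floor_le (by positivity)
    have e1 : 4 / (1 / G) = 4 * G := by field_simp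
    rw [e1] at u1
    have u2 : Real.log (Uf (1 / G) N) ≤ 2 * Real.log N := by
      rcases Nat.eq_zero_or_pos (Uf (1 / G) N) with h0 | h0
      · rw [h0]; simp; rw [hlogN]; positivity
      · have : (2:ℝ) * Real.log N = Real.log ((N:ℝ)^2) := by rw [Real.log_pow]; norm_num
        rw [this]
        apply Real.log_le_log (by exact_mod_cast h0)
        refine u1.trans ?_
        rw [sq]
        gcongr
    have u3 : 1 + Real.log (Uf (1 / G) N) ≤ G := by linarith
    have v1 : ((Hf (1 / G) : ℕ):ℝ) ≤ 400 / (1 / G)^2 := Nat.floor_le (by positivity)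
    rw [inv1] at v1
    have v2 : 2 * ((Hf (1 / G) : ℕ):ℝ) + 1 ≤ 801 * G^2 := by linarith
    have w1 : 4 * (4 * (N:ℝ)) / (q:ℝ)^2 = 16 * E := by rw [hNB, hBE]; field_simp; ring
    have w2 : 4 * (4 * (N:ℝ)) / (B:ℝ) = 16 * q := by rw [hNB]; field_simp; ring
    rw [w1, w2]
    have z1 : (2 * ((Hf (1 / G) : ℕ):ℝ) + 1) * (2 * (1 + 16 * E)) ≤ 801 * G^2 * (34 * E) := by
      apply mul_le_mul v2 (by linarith) (by positivity) (by positivity)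
    have z2 : (PB B).card / (q:ℝ)^2 * (1 + 16 * q) ≤ 17 * (PB B).card / q := by
      rw [div_mul_eq_mul_div, div_le_div_iff₀ (by positivity) hq0]
      have : (PB B).card * (1 + 16 * (q:ℝ)) ≤ (PB B).card * (17 * q) := by gcongr; linarith
      calc _ ≤ (PB B).card * (17 * (q:ℝ)) * q := by gcongr
        _ = _ := by ring
    calc _ ≤ G * (801 * G^2 * (34 * E) + 17 * (PB B).card / q) := by
          apply mul_le_mul u3 (add_le_add z1 z2) (by positivity) hG0.le
      _ = 27234 * G^3 * E + 17 * G * (PB B).card / q := by ring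
      _ ≤ (PB B).card / 2000 + (PB B).card / 2000 := by
          gcongr ?_ + ?_
          · rw [le_div_iff₀ (by norm_num)]
            have : 27234 * G^3 * E * 2000 * G ≤ (PB B).card * G := by
              refine le_trans ?_ hKE
              calc _ = (27234 * 2000 * G^4) * E := by ring
                _ ≤ q * E := by gcongr; linarith
            exact le_of_mul_le_mul_right this hG0
          · rw [div_le_div_iff₀ hq0 (by norm_num)]
            calc _ = (PB B).card * (34000 * G) := by ring
              _ ≤ _ := by gcongr; linarith
      _ = _ := by ring
  refine ⟨q, B, N, ⟨by positivity, hc0, ?_, hq, ?_, hqB, ?_, ?_, ?_, ?_, ?_, ?_, ?_, hQ2, hsum, hexc⟩, ?_⟩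
  · rw [hc]
    rw [div_le_iff₀ (by positivity)]
    linarith
  · have : (2:ℝ) < q := by linarith
    exact_mod_cast this
  · rw [hN, hB]; ring
  · rw [inv1]; linarith
  · rw [inv1]
    have e1 : 64 / (1 / G) = 64 * G := by field_simp
    rw [e1, hNB, hBE]
    have : 64 * G + 400 * G^2 < q := by linarith
    have hx : (1:ℝ) ≤ (q * (q * E))^3 := one_le_pow₀ (by nlinarith only [hq1, hE1, mul_nonneg (sub_nonneg.mpr hq1) hE0.le])
    calc 64 * G * (q * (q * E))^3 + 400 * G^2 ≤ 64 * G * (q * (q * E))^3 + 400 * G^2 * (q * (q * E))^3 := by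
          have : 400 * G^2 * 1 ≤ 400 * G^2 * (q * (q * E))^3 := by gcongr
          linarith
      _ = (64 * G + 400 * G^2) * (q * (q * E))^3 := by ring
      _ < q * (q * (q * E))^3 := by gcongr
      _ ≤ E * (q * (q * E))^3 := by gcongr
      _ = _ := by ring
  · have e1 : 4 / (1 / G) = 4 * G := by field_simp
    rw [e1, hNB, hBE]
    calc 4 * G * (q * (q * E)) < q * (q * (q * E)) := by gcongr; linarith
      _ ≤ E * (q * (q * E)) := by gcongr
      _ = _ := by ring
  · rw [hlogN]
    push_cast at hr0 ⊢
    have : 0 ≤ ((k:ℝ) + 1) * Real.log q := by positivity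
    linarith
  · have e1 : 1 / (1000 * (1 / G)) = G / 1000 := by field_simp
    rw [e1]
    have : 1 * 1 ≤ ((((k + 1 : ℕ):ℝ)) + 1) * Real.log G := by
      apply mul_le_mul <;> linarith
    linarith
  · have e1 : 3 / (1 / G)^2 = 3 * G^2 := by field_simp
    rw [e1]
    have h1 : G^3 ≤ (N:ℝ)^2 := by
      calc G^3 ≤ q * 1 := by linarith
        _ ≤ q * B := by gcongr; linarith
        _ = N * 1 := by rw [hNB]; ring
        _ ≤ N * N := by gcongr; linarith
        _ = _ := by ring
    calc 3 * G^2 ≤ c * G * G^2 := by gcongr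
      _ = c * G^3 := by ring
      _ ≤ _ := by gcongr
  · -- Hölder
    set R : ℝ := ((k + 1 : ℕ):ℝ) with hR
    have hR0 : 0 < R := by linarith
    set s := R / (R + 1) with hs
    have hs0 : 0 < s := by positivity
    have hs1 : s ≤ 1 := by rw [hs, div_le_one (by positivity)]; linarith
    have hlN0 : 0 < Real.log N := by rw [hlogN]; positivity
    have d1 : 1 / ((N:ℝ)^3 * G) ≤ dl N := by
      unfold dl
      apply one_div_le_one_div_of_le (by positivity)
      gcongr
      linarith
    have d2 : 1 / (G^2 * q * (N:ℝ)^2) ≤ (PB B).card * dl N := by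
      calc 1 / (G^2 * q * (N:ℝ)^2) = (B / G) * (1 / ((N:ℝ)^3 * G)) := by rw [hNB]; field_simp
        _ ≤ _ := by gcongr
    have hX : 1 ≤ G^2 * q := by nlinarith only [p2, hq1]
    have d3 : 1 / (G^2 * q * ((N:ℝ)^2)^s) ≤ ((PB B).card * dl N)^s := by
      calc 1 / (G^2 * q * ((N:ℝ)^2)^s) ≤ 1 / ((G^2 * q)^s * ((N:ℝ)^2)^s) := by
            have : (G^2 * (q:ℝ))^s ≤ G^2 * q := by
              calc _ ≤ (G^2 * (q:ℝ))^(1:ℝ) := Real.rpow_le_rpow_of_exponent_le hX hs1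
                _ = _ := Real.rpow_one _
            gcongr
        _ = (1 / (G^2 * q * (N:ℝ)^2))^s := by
            have e : (G^2 * q * (N:ℝ)^2)^s = (G^2 * q)^s * ((N:ℝ)^2)^s := Real.mul_rpow (by positivity) (by positivity)
            rw [Real.div_rpow (by norm_num) (by positivity), Real.one_rpow, e]
        _ ≤ _ := by gcongr
    have d4 : ((N:ℝ)^2)^s * (q:ℝ)^2 = (N:ℝ)^2 := by
      have e1 : (N:ℝ)^2 = (q:ℝ)^(2 * (R + 1)) := by
        rw [hNr, ← pow_mul, ← Real.rpow_natCast]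
        congr 1
        rw [hR]; push_cast; ring
      rw [e1, ← Real.rpow_mul hq0.le, ← Real.rpow_natCast (q:ℝ) 2, ← Real.rpow_add hq0]
      congr 1
      rw [hs]; field_simp; push_cast; ring
    have hns : 0 < ((N:ℝ)^2)^s := by positivity
    calc (8:ℝ) ≤ q / G^3 := by rw [le_div_iff₀ (by positivity)]; linarith
      _ = (((N:ℝ)^2)^s * (q:ℝ)^2) * (1 / G) * (1 / (G^2 * q * ((N:ℝ)^2)^s)) := by field_simp
      _ = (N:ℝ)^2 * (1 / G) * (1 / (G^2 * q * ((N:ℝ)^2)^s)) := by rw [d4]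
      _ ≤ _ := by gcongr


lemma ev_G (r : ℕ) (B0 : ℕ) (c : ℝ) (hc : 0 < c) : ∃ G0 : ℝ, ∀ G ≥ G0, 10^8 ≤ Real.log G ∧
    10000 * (r + 1) * Real.log G ≤ G ∧ 3 ≤ c * G ∧ (B0:ℝ) ≤ G := by
  have e1 : ∀ᶠ G : ℝ in atTop, 10^8 ≤ Real.log G := Real.tendsto_log_atTop.eventually_ge_atTop _
  have e2 := Real.isLittleO_log_id_atTop.def (show (0:ℝ) < 1 / (10000 * (r + 1)) by positivity)
  have e3 : ∀ᶠ G : ℝ in atTop, 3 / c ≤ G := eventually_ge_atTop _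
  have e4 : ∀ᶠ G : ℝ in atTop, (B0:ℝ) ≤ G := eventually_ge_atTop _
  have e5 : ∀ᶠ G : ℝ in atTop, (0:ℝ) ≤ G := eventually_ge_atTop _
  obtain ⟨G0, hG0⟩ := eventually_atTop.mp (e1.and (e2.and (e3.and (e4.and e5))))
  refine ⟨G0, fun G hG => ?_⟩
  obtain ⟨a1, a2, a3, a4, a5⟩ := hG0 G hG
  refine ⟨a1, ?_, ?_, a4⟩
  · rw [Real.norm_eq_abs, Real.norm_eq_abs, id, abs_of_nonneg a5, abs_of_nonneg (by linarith), div_mul_eq_mul_div, le_div_iff₀ (by positivity)] at a2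
    linarith
  · rw [div_le_iff₀ hc] at a3
    linarith

lemma dl_inv {l c : ℝ} {q B N : ℕ} (h : SH l c q B N) : 1 / l ≤ 1 / dl N := by
  have h1 := h.d3
  have hd := h.dpos
  have hN := h.NG
  have hl := h.hl
  have hNb := h.Nbig
  have hG : 0 < 1 / l := by positivity
  rw [le_div_iff₀ hd]
  have h2 : (1 / l) ≤ (N:ℝ)^3 := by
    have : (N:ℝ) ≤ N^3 := le_self_pow₀ (by linarith) (by norm_num)
    linarith
  calc 1 / l * dl N ≤ (N:ℝ)^3 * dl N := by gcongr
    _ = dl N * (N:ℝ)^3 := by ring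
    _ ≤ 1 := by linarith

lemma liminf_pos_of (u : ℕ → ℝ) (c : ℝ) (hc : 0 < c) (h1 : ∀ᶠ n in atTop, c ≤ u n) (h2 : ∃ᶠ n in atTop, u n ≤ 256) :
    0 < atTop.liminf u := by
  refine lt_of_lt_of_le hc (le_liminf_of_le ?_ h1)
  exact IsCoboundedUnder.of_frequently_le h2

theorem dim_r (r : ℕ) (hr : 2 ≤ r) (s : NNReal) (hsr : (s:ℝ) = (r:ℝ) / (r + 1)) : 
    (s : ENNReal) ≤ dimH {ξ : ℝ |
      0 < atTop.liminf (fun n : ℕ =>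
        (n : ℝ) * Real.log n * nint (ξ * (n : ℝ) ^ 2))} := by
  obtain ⟨B0, hB0⟩ := primes_count
  set c : ℝ := 1 / 10^12 / (r + 1) with hc
  have hr0 : (2:ℝ) ≤ r := by exact_mod_cast hr
  have hc0 : 0 < c := by positivity
  have hc12 : c ≤ 1 / 10^12 := by
    rw [hc, div_le_iff₀ (by positivity)]
    linarith
  have hs0 : (0:ℝ) < s := by rw [hsr]; positivity
  have hs1 : (s:ℝ) ≤ 1 := by rw [hsr, div_le_one (by positivity)]; linarith
  obtain ⟨G0, hG0⟩ := ev_G r B0 c hc0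
  have hex : ∀ l : {l : ℝ // 0 < l ∧ G0 ≤ 1 / l}, ∃ q B N : ℕ, SH l.1 c q B N ∧ 8 ≤ (N:ℝ)^2 * l.1 * ((PB B).card * dl N)^(s:ℝ) := by
    rintro ⟨l, hl, hl2⟩
    obtain ⟨a1, a2, a3, a4⟩ := hG0 (1 / l) hl2
    have := num r hr B0 hB0 c hc (1 / l) a1 a2 a3 a4
    rw [one_div_one_div] at this
    rw [hsr]
    exact this
  choose qf Bf Nf hSH hHo using hex
  let nxt : {l : ℝ // 0 < l ∧ G0 ≤ 1 / l} → {l : ℝ // 0 < l ∧ G0 ≤ 1 / l} := 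
    fun l => ⟨dl (Nf l), (hSH l).dpos, l.2.2.trans (dl_inv (hSH l))⟩
  have hG1 : 0 < max G0 1 := lt_of_lt_of_le one_pos (le_max_right _ _)
  let st0 : {l : ℝ // 0 < l ∧ G0 ≤ 1 / l} := ⟨1 / max G0 1, by positivity, by
    rw [one_div_one_div]; exact le_max_left _ _⟩
  let st : ℕ → {l : ℝ // 0 < l ∧ G0 ≤ 1 / l} := fun k => Nat.rec st0 (fun _ p => nxt p) k
  let l : ℕ → ℝ := fun k => (st k).1
  let N : ℕ → ℕ := fun k => Nf (st k)
  let B : ℕ → ℕ := fun k => Bf (st k)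
  let q : ℕ → ℕ := fun k => qf (st k)
  have hsh : ∀ k, SH (l k) c (q k) (B k) (N k) := fun k => hSH (st k)
  have hho : ∀ k, 8 ≤ (N k:ℝ)^2 * l k * ((PB (B k)).card * dl (N k))^(s:ℝ) := fun k => hHo (st k)
  have hlS : ∀ k, l (k+1) = dl (N k) := fun k => rfl
  have hl0 : ∀ k, 0 < l k := fun k => (st k).2.1
  have hl1 : ∀ k, l k ≤ 1 := by
    intro k
    have := (hsh k).Gbig
    rw [le_div_iff₀ (hl0 k)] at this
    nlinarith [hl0 k]
  let S : ℕ → ℕ := fun k => Nat.rec (Qf (l 0)) (fun j _ => 4 * N j) k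
  have hSS : ∀ k, S (k+1) = 4 * N k := fun k => rfl
  have hS2 : ∀ k, 2 ≤ S k := by
    intro k
    cases k with
    | zero => exact (hsh 0).hQ2
    | succ j => rw [hSS]; have := (hsh j).N2; omega
  have hSN : ∀ k, S k < N k := by
    intro k
    cases k with
    | zero => exact (hsh 0).QlN
    | succ j => 
      rw [hSS]
      have h1 := (hsh j).N4Q
      have h2 := (hsh (j+1)).QlN
      rw [hlS] at h2
      omega
  have hSk : ∀ k, k ≤ S k := by
    intro k
    induction k with
    | zero => omega
    | succ j ih => rw [hSS]; have := hSN j; omega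
  let M : ℕ → ℕ := fun k => Mf (l k) (B k) (N k)
  let C : ℝ := 144 / (l 0)^(s:ℝ)
  have hl0s : 0 < (l 0)^(s:ℝ) := Real.rpow_pos_of_pos (hl0 0) _
  have hC : 0 ≤ C := by positivity
  have hinv : ∀ k, 144 ≤ C * (∏ i ∈ Finset.range k, (M i : ℝ)) * (l k)^(s:ℝ) := by
    intro k
    induction k with
    | zero => 
      rw [Finset.prod_range_zero, mul_one]
      show 144 ≤ 144 / (l 0)^(s:ℝ) * (l 0)^(s:ℝ)
      rw [div_mul_cancel₀ _ hl0s.ne']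
    | succ j ih =>
      have := (hsh j).inv_next (hl1 j) hs0 hs1 (hho j) (by positivity) ih
      rw [hlS, Finset.prod_range_succ, ← mul_assoc]
      exact this
  let Good : ℕ → ℝ → Prop := fun k x => Fut x (l k) (S k) (Qf (l k)) ≤ 10^7 * l k ∧ 
    ∀ j, k = j + 1 → 
      (∀ z, x ≤ z → z ≤ x + l k → ∀ m : ℕ, S j < m → m ≤ S k → c / ((m:ℝ) * Real.log m) ≤ nint (z * (m:ℝ)^2)) ∧
      (∃ n : ℕ, N j < n ∧ ∀ z, x ≤ z → z ≤ x + l k → (n:ℝ) * Real.log n * nint (z * (n:ℝ)^2) ≤ 256)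
  have hcd := cantor_dim s (by exact_mod_cast hs0) M (fun k => ((hsh k).Kfacts hs0 (hho k)).2.2.1) l hl0 Good 0 (by
      refine ⟨?_, fun j hj => by omega⟩
      have : Fut 0 (l 0) (S 0) (Qf (l 0)) = 0 := by
        show Fut 0 (l 0) (Qf (l 0)) (Qf (l 0)) = 0
        unfold Fut
        rw [Finset.Ioc_self, Finset.sum_empty]
      rw [this]
      have := hl0 0
      positivity) C hC (by
      intro k x hx
      obtain ⟨y, y1, y2⟩ := (hsh k).step1 (hl1 k) hc12 (hS2 k) (hSN k).le hx.1 hs0 hs1 (hho k) (by positivity) (hinv k)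
      refine ⟨y, ?_, ?_⟩
      · intro i hi
        obtain ⟨z1, z2, z3, z4, z5⟩ := y1 i hi
        refine ⟨⟨z5, ?_⟩, z1, z2⟩
        intro j hj
        have : k = j := by omega
        subst this
        exact ⟨z3, z4⟩
      · intro i j hij hj
        obtain ⟨w1, w2⟩ := y2 i j hij hj
        refine ⟨w1, ?_⟩
        rw [Finset.prod_range_succ, ← mul_assoc]
        exact w2)
  refine hcd.trans (dimH_mono ?_)
  rintro ξ ⟨X, hX⟩
  have hclean : ∀ k, ∀ m : ℕ, S 0 < m → m ≤ S k → c / ((m:ℝ) * Real.log m) ≤ nint (ξ * (m:ℝ)^2) := by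
    intro k
    induction k with
    | zero => intro m h1 h2; omega
    | succ j ih =>
      intro m h1 h2
      rcases le_or_gt m (S j) with h3 | h3
      · exact ih m h1 h3
      · obtain ⟨x1, x2, x3⟩ := hX (j+1)
        exact (x1.2 j rfl).1 ξ x2 x3 m h3 h2
  rw [Set.mem_setOf_eq]
  apply liminf_pos_of _ c hc0
  · rw [eventually_atTop]
    refine ⟨S 0 + 1, fun m hm => ?_⟩
    have h1 := hclean m m (by omega) (hSk m)
    have hm2 : 2 ≤ m := by have := hS2 0; omega
    have := log_nat_pos hm2
    have hm0 : (0:ℝ) < m := by exact_mod_cast (show 0 < m by omega)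
    rw [div_le_iff₀ (by positivity)] at h1
    linarith
  · rw [frequently_atTop]
    intro a
    obtain ⟨x1, x2, x3⟩ := hX (a+1)
    obtain ⟨n, hn, hn2⟩ := (x1.2 a rfl).2
    refine ⟨n, ?_, hn2 ξ x2 x3⟩
    have := hSk a
    have := hSN a
    omega

theorem stmt_18 :
    dimH {ξ : ℝ |
      0 < atTop.liminf (fun n : ℕ =>
        (n : ℝ) * Real.log n * nint (ξ * (n : ℝ) ^ 2))} = 1 := by
  apply le_antisymm
  · refine (dimH_mono (Set.subset_univ _)).trans ?_
    rw [Real.dimH_univ]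
  · apply ENNReal.le_of_forall_nnreal_lt
    intro t ht
    have ht1 : (t:ℝ) < 1 := by exact_mod_cast ht
    obtain ⟨n, hn⟩ := exists_nat_one_div_lt (sub_pos.mpr ht1)
    have hnn : (0:ℝ) ≤ ((n + 2 : ℕ):ℝ) / (((n + 2 : ℕ):ℝ) + 1) := by positivity
    obtain ⟨s, hs⟩ : ∃ s : NNReal, (s:ℝ) = ((n + 2 : ℕ):ℝ) / (((n + 2 : ℕ):ℝ) + 1) := ⟨⟨_, hnn⟩, rfl⟩
    refine le_trans ?_ (dim_r (n + 2) (by omega) s hs)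
    apply ENNReal.coe_le_coe.mpr
    rw [← NNReal.coe_le_coe, hs]
    rw [le_div_iff₀ (by positivity)]
    rw [div_lt_iff₀ (by positivity)] at hn
    push_cast
    nlinarith
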